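/- arXiv:1006.0161 — 13 statements merged into one kernel-verified Lean document; each statement's English description precedes it below -/
import Mathlib

section
/- Let V = V₀ ⊔ V₁ be a finite set and let A be a skew-symmetric integer matrix indexed by V of block form A = [[0, B], [−Bᵀ, 0]], where the rows of B are indexed by V₀ and the columns by V₁. Then the following are equivalent: (1) A is principally unimodular, i.e. det A(s) ∈ {0, 1} for every state s ⊆ V; (2) every minor of A lies in {−1, 0, 1}; (3) every minor of B lies in {−1, 0, 1}. -/
open Matrix

namespace Matrix

variable {n R : Type*} [Fintype n] [DecidableEq n] [CommRing R]

theorem exists_perm_forall_ne_zero_of_det_ne_zero {M : Matrix n n R} (h : M.det ≠ 0) :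
    ∃ σ : Equiv.Perm n, ∀ i, M (σ i) i ≠ 0 := by
  rw [det_apply] at h
  obtain ⟨σ, -, hσ⟩ := Finset.exists_ne_zero_of_sum_ne_zero h
  refine ⟨σ, fun i hi => hσ ?_⟩
  have hprod : ∏ j, M (σ j) j = 0 := Finset.prod_eq_zero (Finset.mem_univ i) hi
  exact (congrArg _ hprod).trans (smul_zero _)

theorem det_fromBlocks_zero_neg_transpose (C : Matrix n n R) :
    (fromBlocks 0 C (-Cᵀ) 0).det = C.det * C.det := by
  have h : fromBlocks 0 C (-Cᵀ) 0 =
      fromBlocks C 0 0 Cᵀ *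
        (fromBlocks 1 1 0 1 * fromBlocks 1 0 (-1) 1 * fromBlocks 1 1 0 1) := by
    simp [fromBlocks_multiply]
  simp [h, det_mul]

/-- A skew-symmetric matrix whose support is bipartite has square determinant. -/
theorem isSquare_det_of_transpose_eq_neg {M : Matrix n n R} (p : n → Prop) [DecidablePred p]
    (hM : Mᵀ = -M) (h0 : ∀ i j, (p i ↔ p j) → M i j = 0) : IsSquare M.det := by
  by_cases hdet : M.det = 0
  · simp [hdet]
  obtain ⟨σ, hσ⟩ := exists_perm_forall_ne_zero_of_det_ne_zero hdet
  have hp : ∀ i, p i ↔ ¬ p (σ i) := fun i => by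
    have := mt (h0 (σ i) i) (hσ i)
    tauto
  let τ : {i // p i} ≃ {i // ¬ p i} := σ.subtypeEquiv hp
  let e : {i // p i} ⊕ {i // p i} ≃ n :=
    (Equiv.sumCongr (Equiv.refl _) τ).trans (Equiv.sumCompl p)
  let C : Matrix {i // p i} {i // p i} R := of fun i j => M i (τ j)
  have hC : M.submatrix e e = fromBlocks 0 C (-Cᵀ) 0 := by
    have hskew : ∀ i j, M i j = -M j i := fun i j => congr_fun₂ hM j i
    ext (i | i) (j | j)
    · exact h0 _ _ (iff_of_true i.2 j.2)
    · rfl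
    · exact hskew _ _
    · exact h0 _ _ (iff_of_false (τ i).2 (τ j).2)
  rw [← det_submatrix_equiv_self e, hC, det_fromBlocks_zero_neg_transpose]
  exact ⟨_, rfl⟩

theorem mem_range_signType_cast_iff {x : ℤ} :
    x ∈ Set.range (SignType.cast : SignType → ℤ) ↔ x ∈ ({-1, 0, 1} : Set ℤ) := by
  constructor
  · rintro ⟨s, rfl⟩
    cases s <;> simp
  · rintro (rfl | rfl | rfl)
    exacts [⟨-1, rfl⟩, ⟨0, rfl⟩, ⟨1, rfl⟩]

theorem isTotallyUnimodular_int_iff {l m : Type*} (A : Matrix l m ℤ) :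
    A.IsTotallyUnimodular ↔ ∀ (k : ℕ) (f : Fin k → l) (g : Fin k → m),
      Function.Injective f → Function.Injective g →
        (A.submatrix f g).det ∈ ({-1, 0, 1} : Set ℤ) := by
  simp only [IsTotallyUnimodular, mem_range_signType_cast_iff]

theorem IsTotallyUnimodular.det_mem {l m : Type*} {A : Matrix l m R}
    (hA : A.IsTotallyUnimodular) (f : n → l) (g : n → m) :
    (A.submatrix f g).det ∈ Set.range SignType.cast := by
  let e := (Fintype.equivFin n).symm
  rw [← det_submatrix_equiv_self e, submatrix_submatrix]
  exact (isTotallyUnimodular_iff A).1 hA _ _ _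

theorem IsTotallyUnimodular.neg {l m : Type*} {A : Matrix l m R}
    (hA : A.IsTotallyUnimodular) : (-A).IsTotallyUnimodular := by
  intro k f g hf hg
  obtain ⟨s, hs⟩ := hA k f g hf hg
  refine ⟨(-1) ^ k * s, ?_⟩
  rw [submatrix_neg, Pi.neg_apply, Pi.neg_apply, det_neg, ← hs]
  simp

theorem IsTotallyUnimodular.fromBlocks_antidiagonal {l l' m m' : Type*}
    {X : Matrix l m' R} {Y : Matrix l' m R}
    (hX : X.IsTotallyUnimodular) (hY : Y.IsTotallyUnimodular) :
    (fromBlocks 0 X Y 0).IsTotallyUnimodular := by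
  intro k f g _ _
  set M := (fromBlocks 0 X Y 0).submatrix f g with hMdef
  by_cases hdet : M.det = 0
  · exact ⟨0, by simp [hdet]⟩
  obtain ⟨σ, hσ⟩ := exists_perm_forall_ne_zero_of_det_ne_zero hdet
  have hside : ∀ i, (f (σ i)).isLeft = (g i).isRight := by
    intro i
    have := hσ i
    simp only [hMdef, submatrix_apply] at this
    rcases hf : f (σ i) with a | a <;> rcases hg : g i with b | b <;> simp_all
  let p : Fin k → Prop := fun i => (f (σ i)).isLeft
  have hg : ∀ i, p i → (g i).isRight := fun i hi => hside i ▸ hi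
  have hf' : ∀ i, ¬ p i → (f (σ i)).isRight := fun i hi => by simpa [p] using hi
  have hg' : ∀ i, ¬ p i → (g i).isLeft := fun i hi => by
    have := hside i
    simp only [p] at hi
    rcases h : g i with b | b <;> simp_all
  have hoff : ∀ i, ¬ p i → ∀ j, p j → M.submatrix σ id i j = 0 := by
    intro i hi j hj
    obtain ⟨a, ha⟩ := Sum.isRight_iff.1 (hf' i hi)
    obtain ⟨b, hb⟩ := Sum.isRight_iff.1 (hg j hj)
    simp [hMdef, ha, hb]
  have hblock := twoBlockTriangular_det _ p hoff
  have h₁ : toSquareBlockProp (M.submatrix σ id) p =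
      X.submatrix (fun i : {i // p i} => (f (σ i)).getLeft i.2)
        (fun i : {i // p i} => (g i).getRight (hg i i.2)) := by
    ext i j
    obtain ⟨a, ha⟩ := Sum.isLeft_iff.1 i.2
    obtain ⟨b, hb⟩ := Sum.isRight_iff.1 (hg j j.2)
    simp [toSquareBlockProp, hMdef, ha, hb]
  have h₂ : toSquareBlockProp (M.submatrix σ id) (fun i => ¬ p i) =
      Y.submatrix (fun i : {i // ¬ p i} => (f (σ i)).getRight (hf' i i.2))
        (fun i : {i // ¬ p i} => (g i).getLeft (hg' i i.2)) := by
    ext i j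
    obtain ⟨a, ha⟩ := Sum.isRight_iff.1 (hf' i i.2)
    obtain ⟨b, hb⟩ := Sum.isLeft_iff.1 (hg' j j.2)
    simp [toSquareBlockProp, hMdef, ha, hb]
  obtain ⟨s, hs⟩ := hX.det_mem (fun i : {i // p i} => (f (σ i)).getLeft i.2)
    (fun i => (g i).getRight (hg i i.2))
  obtain ⟨t, ht⟩ := hY.det_mem (fun i : {i // ¬ p i} => (f (σ i)).getRight (hf' i i.2))
    (fun i => (g i).getLeft (hg' i i.2))
  rw [h₁, h₂, ← hs, ← ht, det_permute] at hblock
  rcases Int.units_eq_one_or (Equiv.Perm.sign σ) with hsign | hsign <;> rw [hsign] at hblock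
  · exact ⟨s * t, by simpa using hblock.symm⟩
  · exact ⟨-(s * t), by simp only [SignType.coe_neg, SignType.coe_mul, ← hblock]; simp⟩

end Matrix

/-- For `A = [[0, B], [-Bᵀ, 0]]` skew-symmetric over `ℤ`, TFAE:
(1) `A` is principally unimodular (`det A(s) ∈ {0,1}` for every state `s`);
(2) every minor of `A` lies in `{-1,0,1}`;
(3) every minor of `B` lies in `{-1,0,1}`. -/
theorem stmt0 {V₀ V₁ : Type*} [Fintype V₀] [Fintype V₁] [DecidableEq V₀] [DecidableEq V₁]
    (B : Matrix V₀ V₁ ℤ) (A : Matrix (V₀ ⊕ V₁) (V₀ ⊕ V₁) ℤ)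
    (hA : A = Matrix.fromBlocks 0 B (-Bᵀ) 0) :
    List.TFAE
      [∀ s : Finset (V₀ ⊕ V₁),
          (A.submatrix (Subtype.val : {x // x ∈ s} → (V₀ ⊕ V₁)) Subtype.val).det
            ∈ ({0, 1} : Set ℤ),
       ∀ (k : ℕ) (f : Fin k → V₀ ⊕ V₁) (g : Fin k → V₀ ⊕ V₁),
          Function.Injective f → Function.Injective g →
          (A.submatrix f g).det ∈ ({-1, 0, 1} : Set ℤ),
       ∀ (k : ℕ) (f : Fin k → V₀) (g : Fin k → V₁),
          Function.Injective f → Function.Injective g →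
          (B.submatrix f g).det ∈ ({-1, 0, 1} : Set ℤ)] := by
  rw [← isTotallyUnimodular_int_iff, ← isTotallyUnimodular_int_iff]
  subst hA
  tfae_have 3 → 2 := fun hB => hB.fromBlocks_antidiagonal hB.transpose.neg
  tfae_have 2 → 1 := by
    intro h s
    have hsq : IsSquare ((fromBlocks 0 B (-Bᵀ) 0).submatrix
        (Subtype.val : {x // x ∈ s} → (V₀ ⊕ V₁)) Subtype.val).det := by
      refine isSquare_det_of_transpose_eq_neg (fun x => x.1.isLeft) ?_ ?_
      · rw [transpose_submatrix, fromBlocks_transpose]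
        ext ⟨i | i, hi⟩ ⟨j | j, hj⟩ <;> simp
      · rintro ⟨i | i, hi⟩ ⟨j | j, hj⟩ <;> simp
    rcases mem_range_signType_cast_iff.1
      (h.det_mem (Subtype.val : {x // x ∈ s} → V₀ ⊕ V₁) Subtype.val)
      with hd | hd | hd
    · exact absurd hsq.nonneg (by rw [hd]; norm_num)
    · exact Or.inl hd
    · exact Or.inr hd
  tfae_have 1 → 3 := by
    intro h
    rw [isTotallyUnimodular_int_iff]
    intro k f g hf hg
    have hinj : Function.Injective (Sum.map f g) := hf.sumMap hg
    let e : Fin k ⊕ Fin k ≃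
        {x : V₀ ⊕ V₁ // x ∈ Finset.univ.image (Sum.map f g)} :=
      (Equiv.ofInjective _ hinj).trans
        (Equiv.subtypeEquivRight fun x => by simp only [Set.mem_range, Finset.mem_image,
          Finset.mem_univ, true_and])
    have hs := h (Finset.univ.image (Sum.map f g))
    have hC : (fromBlocks 0 B (-Bᵀ) 0).submatrix (Subtype.val ∘ e) (Subtype.val ∘ e) =
        fromBlocks 0 (B.submatrix f g) (-(B.submatrix f g)ᵀ) 0 := by
      ext (i | i) (j | j) <;> rfl
    rw [← det_submatrix_equiv_self e, submatrix_submatrix, hC,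
      det_fromBlocks_zero_neg_transpose] at hs
    rcases hs with hs | hs
    · exact Or.inr (Or.inl (mul_self_eq_zero.1 hs))
    · rcases mul_self_eq_one_iff.1 hs with hs | hs
      · exact Or.inr (Or.inr hs)
      · exact Or.inl hs
  tfae_finish
end

section
/- Let A be a principally unimodular skew-symmetric integer matrix indexed by a finite set V with all entries in {−1, 0, 1}, and let u, v, w ∈ V be distinct elements such that A u v = A u w = 1 and A u t = 0 for every t ∉ {v, w}. Then for every t ∉ {u, v, w}, the combination (A v t) ∧ (A w t) never takes the values (1, −1) or (−1, 1); equivalently, A v t − A w t ∈ {−1, 0, 1} for all t ∉ {u, v, w}. -/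
open Matrix

/-- A principal minor indexed by a finite set, read along an injective enumeration of that set. -/
theorem Matrix.det_submatrix_range_of_injective {V R ι : Type*} [DecidableEq V] [CommRing R]
    [Fintype ι] [DecidableEq ι] (A : Matrix V V R) {f : ι → V} (hf : Function.Injective f) :
    (A.submatrix (Subtype.val : {x // x ∈ Finset.univ.image f} → V) Subtype.val).det =
      (A.submatrix f f).det := by
  let g : ι → {x // x ∈ Finset.univ.image f} :=
    fun i => ⟨f i, Finset.mem_image_of_mem f (Finset.mem_univ i)⟩
  have hg : Function.Bijective g := by
    refine ⟨fun i j h => hf (congrArg Subtype.val h), ?_⟩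
    rintro ⟨x, hx⟩
    obtain ⟨i, -, rfl⟩ := Finset.mem_image.mp hx
    exact ⟨i, rfl⟩
  rw [← det_submatrix_equiv_self (Equiv.ofBijective g hg), submatrix_submatrix]
  rfl

/-- The determinant of a `4 × 4` skew-symmetric matrix is the square of its Pfaffian. -/
theorem Matrix.det_fin_four_skew {R : Type*} [CommRing R] (a b c d e f : R) :
    (!![0, a, b, c; -a, 0, d, e; -b, -d, 0, f; -c, -e, -f, 0]).det =
      (a * f - b * e + c * d) ^ 2 := by
  simp [det_succ_row_zero, Fin.sum_univ_succ, Fin.succAbove]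
  ring

/-- in a principally unimodular skew-symmetric `±1/0` matrix, if `u` is
adjacent exactly to `v` and `w` with `A u v = A u w = 1`, then for every other vertex
`t` the pair `(A v t, A w t)` never equals `(1, -1)` or `(-1, 1)`; equivalently
`A v t - A w t ∈ {-1, 0, 1}`. -/
theorem stmt5 {V : Type*} [Fintype V] [DecidableEq V]
    (A : Matrix V V ℤ) (hskew : Aᵀ = -A)
    (hent : ∀ i j, A i j ∈ ({-1, 0, 1} : Set ℤ))
    (hPU : ∀ s : Finset V,
      (A.submatrix (Subtype.val : {x // x ∈ s} → V) Subtype.val).det ∈ ({0, 1} : Set ℤ))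
    (u v w : V) (huv : u ≠ v) (huw : u ≠ w) (hvw : v ≠ w)
    (h1 : A u v = 1) (h2 : A u w = 1)
    (h3 : ∀ t, t ≠ v → t ≠ w → A u t = 0) :
    ∀ t, t ≠ u → t ≠ v → t ≠ w → A v t - A w t ∈ ({-1, 0, 1} : Set ℤ) := by
  intro t htu htv htw
  have hneg (i j : V) : A j i = -A i j := congrFun (congrFun hskew i) j
  have hdiag (i : V) : A i i = 0 := by have := hneg i i; omega
  have hf : Function.Injective ![u, v, w, t] := by
    intro i j h
    clear hneg hdiag
    fin_cases i <;> fin_cases j <;> simp_all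
  have hM : A.submatrix ![u, v, w, t] ![u, v, w, t] =
      !![0, 1, 1, 0; -1, 0, A v w, A v t; -1, -A v w, 0, A w t; -0, -A v t, -A w t, 0] := by
    ext i j
    fin_cases i <;> fin_cases j <;>
      simp [hdiag, h1, h2, h3 t htv htw, hneg u v, hneg u w, hneg u t, hneg v w, hneg v t,
        hneg w t]
  have hdet := hPU (Finset.univ.image ![u, v, w, t])
  rw [det_submatrix_range_of_injective A hf, hM, det_fin_four_skew] at hdet
  simp only [Set.mem_insert_iff, Set.mem_singleton_iff] at hdet ⊢
  have hle : (A v t - A w t) ^ 2 ≤ 1 := by rcases hdet with h | h <;> linarith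
  have := abs_le.mp ((sq_le_one_iff_abs_le_one _).mp hle)
  omega
end

section
/- Let A be a skew-symmetric integer matrix indexed by a finite set V, and let u, v, w ∈ V be distinct with A u v = A u w = 1, A v w = 0, and A u t = 0 for all t ∉ {v, w}. Define A' to be the skew-symmetric integer matrix that agrees with A on all pairs of elements of V \ {u}, and whose row at u is given by A' u v = A' u w = 0 and A' u t = A v t − A w t for t ∉ {u, v, w} (with A' t u = −A' u t). Then A is principally unimodular if and only if A' is principally unimodular. -/
open Matrix

/-- A skew-symmetric integer matrix is principally unimodular if every principal
minor `det A(s)` is `0` or `1`. -/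
def IsPU {V : Type*} [DecidableEq V] (A : Matrix V V ℤ) : Prop :=
  ∀ s : Finset V,
    (A.submatrix (Subtype.val : {x // x ∈ s} → V) Subtype.val).det ∈ ({0, 1} : Set ℤ)

/-- The matrix `A(s)` extended to all of `V` by an identity block off `s`. -/
def padded {V : Type*} [DecidableEq V] (A : Matrix V V ℤ) (s : Finset V) : Matrix V V ℤ :=
  fun i j => if i ∈ s ∧ j ∈ s then A i j else if i = j then 1 else 0

theorem det_padded {V : Type*} [Fintype V] [DecidableEq V] (A : Matrix V V ℤ) (s : Finset V) :
    (padded A s).det =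
      (A.submatrix (Subtype.val : {x // x ∈ s} → V) Subtype.val).det := by
  rw [Matrix.twoBlockTriangular_det (padded A s) (· ∈ s)]
  · have hs : (padded A s).toSquareBlockProp (· ∈ s) =
        A.submatrix (Subtype.val : {x // x ∈ s} → V) Subtype.val := by
      ext ⟨i, hi⟩ ⟨j, hj⟩
      simp [toSquareBlockProp, padded, hi, hj]
    have hc : (padded A s).toSquareBlockProp (fun i => ¬ i ∈ s) = 1 := by
      ext ⟨i, hi⟩ ⟨j, hj⟩
      simp [toSquareBlockProp, padded, hi, Matrix.one_apply]
    rw [hs, hc, det_one, mul_one]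
    convert rfl
  · intro i hi j hj
    have : i ≠ j := fun h => hi (h ▸ hj)
    simp [padded, hi, this]

theorem isPU_iff_det_padded {V : Type*} [Fintype V] [DecidableEq V] (A : Matrix V V ℤ) :
    IsPU A ↔ ∀ s, (padded A s).det = 0 ∨ (padded A s).det = 1 := by
  simp only [IsPU, det_padded, Set.mem_insert_iff, Set.mem_singleton_iff]

/-- If row `u` is supported at `v`, the determinant does not depend on the other entries of
column `v`. -/
theorem det_eq_of_row_support {V R : Type*} [Fintype V] [DecidableEq V] [CommRing R]
    {M N : Matrix V V R} {u v : V}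
    (hM : ∀ j, j ≠ v → M u j = 0) (hN : ∀ j, j ≠ v → N u j = 0)
    (h : ∀ i j, i = u ∨ j ≠ v → M i j = N i j) : M.det = N.det := by
  rw [det_apply, det_apply]
  refine Finset.sum_congr rfl fun σ _ => ?_
  congr 1
  by_cases hσ : σ v = u
  · refine Finset.prod_congr rfl fun i _ => h _ _ ?_
    by_cases hi : i = v
    · exact Or.inl (hi ▸ hσ)
    · exact Or.inr hi
  · have hne : σ.symm u ≠ v := fun h => hσ (by rw [← h, Equiv.apply_symm_apply])
    rw [Finset.prod_eq_zero (Finset.mem_univ (σ.symm u)) (by simpa using hM _ hne),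
      Finset.prod_eq_zero (Finset.mem_univ (σ.symm u)) (by simpa using hN _ hne)]

/-- Eliminating a hyperbolic pair `u, v` whose row and column at `u` are supported at `v`. -/
theorem det_eq_of_pivot {V : Type*} [Fintype V] [DecidableEq V]
    {M N : Matrix V V ℤ} {u v : V} (huv : u ≠ v)
    (hr : ∀ j, M u j = if j = v then 1 else 0) (hc : ∀ i, M i u = if i = v then -1 else 0)
    (hN : ∀ i j, N i j = if i = u ∨ i = v ∨ j = u ∨ j = v then (if i = j then 1 else 0)
      else M i j) : M.det = N.det := by
  let K : Matrix V V ℤ := fun i j => if i ≠ u ∧ j = v then 0 else M i j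
  let L : Matrix V V ℤ := fun i j => (if i = v then -1 else 1) * N (Equiv.swap u v i) j
  have hL : ∀ i j, L i j = (if i = v then -1 else 1) *
      N (if i = u then v else if i = v then u else i) j := fun i j => by
    simp only [L, Equiv.swap_apply_def]
  have hMK : M.det = K.det := by
    apply det_eq_of_row_support (u := u) (v := v) <;> grind
  have hKL : K.det = L.det := by
    rw [← det_transpose K, ← det_transpose L]
    apply det_eq_of_row_support (u := u) (v := v)
    · intro j hj
      simp only [transpose_apply]
      grind
    · intro j hj
      simp only [transpose_apply, hL]
      grind
    · intro i j hij
      simp only [transpose_apply, hL]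
      by_cases hi : j = u <;> by_cases hj : j = v <;> grind
  have hLN : L.det = N.det := by
    have := det_mul_column (fun i => if i = v then (-1 : ℤ) else 1)
      (N.submatrix (Equiv.swap u v) id)
    rw [det_permute, Equiv.Perm.sign_swap huv] at this
    have hprod : (∏ i, if i = v then (-1 : ℤ) else 1) = -1 := by simp
    rw [hprod] at this
    refine Eq.trans this ?_
    simp
  rw [hMK, hKL, hLN]

theorem det_signed_conj {V : Type*} [Fintype V] [DecidableEq V]
    {M N : Matrix V V ℤ} (σ : Equiv.Perm V) (ε : V → ℤ) (hε : ∀ i, ε i * ε i = 1)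
    (h : ∀ i j, M i j = ε i * (ε j * N (σ i) (σ j))) : M.det = N.det := by
  have hM : M = of fun i j => ε i * (of fun i j => ε j * (N.submatrix σ σ) i j) i j := by
    ext i j
    simpa using h i j
  rw [hM, det_mul_column, det_mul_row, det_submatrix_equiv_self, ← mul_assoc,
    ← Finset.prod_mul_distrib]
  simp [hε]

/-- Adding `c` times row `l` to row `k`, and the same for columns, preserves the determinant. -/
theorem det_add_row_col {V R : Type*} [Fintype V] [DecidableEq V] [CommRing R]
    {M N : Matrix V V R} {k l : V} (hkl : k ≠ l) (c : R)
    (h : ∀ i j, N i j = M i j + (if i = k then c * M l j else 0) +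
      (if j = k then c * (M i l + if i = k then c * M l l else 0) else 0)) :
    M.det = N.det := by
  rw [← det_updateRow_add_smul_self M hkl c,
    ← det_updateCol_add_smul_self (updateRow M k (M k + c • M l)) hkl c]
  congr 1
  ext i j
  rw [h]
  by_cases hi : i = k <;> by_cases hj : j = k <;> subst_vars <;>
    simp_all [updateRow_apply]

/-- move Ω₃: if `u` is adjacent exactly to `v` and `w` with
`A u v = A u w = 1` and `A v w = 0`, and `A'` agrees with `A` away from `u` while the
`u`-row of `A'` is `A' u v = A' u w = 0`, `A' u t = A v t - A w t` otherwise, then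
`A` is principally unimodular iff `A'` is. -/
theorem stmt6 {V : Type*} [Fintype V] [DecidableEq V]
    (A A' : Matrix V V ℤ) (hA : Aᵀ = -A) (hA' : A'ᵀ = -A')
    (u v w : V) (huv : u ≠ v) (huw : u ≠ w) (hvw : v ≠ w)
    (h1 : A u v = 1) (h2 : A u w = 1) (h3 : A v w = 0)
    (h4 : ∀ t, t ≠ v → t ≠ w → A u t = 0)
    (h5 : ∀ x y, x ≠ u → y ≠ u → A' x y = A x y)
    (h6 : A' u v = 0) (h7 : A' u w = 0)
    (h8 : ∀ t, t ≠ u → t ≠ v → t ≠ w → A' u t = A v t - A w t) :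
    IsPU A ↔ IsPU A' := by
  have skew : ∀ i j, A i j = -A j i := fun i j => by
    simpa using congrFun (congrFun hA j) i
  have skew' : ∀ i j, A' i j = -A' j i := fun i j => by
    simpa using congrFun (congrFun hA' j) i
  have diag : ∀ i, A i i = 0 := fun i => by have := skew i i; omega
  have diag' : ∀ i, A' i i = 0 := fun i => by have := skew' i i; omega
  have row : ∀ t, A' u t = A v t - A w t := fun t => by
    by_cases htu : t = u
    · grind
    by_cases htv : t = v
    · grind
    by_cases htw : t = w
    · grind
    exact h8 t htu htv htw
  have col : ∀ t, A' t u = A t v - A t w := fun t => by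
    rw [skew', row, skew v, skew w]; ring
  have rowA : ∀ t, A u t = if t = v ∨ t = w then 1 else 0 := fun t => by
    split_ifs with h
    · rcases h with rfl | rfl <;> assumption
    · exact h4 t (by grind) (by grind)
  have colA : ∀ t, A t u = if t = v ∨ t = w then -1 else 0 := fun t => by
    rw [skew, rowA]; split_ifs <;> simp
  have hwv : A w v = 0 := by rw [skew, h3, neg_zero]
  have hval : ∀ i j, A' i j = if i = u then A v j - A w j
      else if j = u then A i v - A i w else A i j := fun i j => by
    split_ifs with hi hj
    · rw [hi, row]
    · rw [hj, col]
    · exact h5 i j hi hj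
  clear h4 h5 h6 h7 h8 skew skew' diag' row col hA' hA
  -- principal minors avoiding `u`
  have avoid : ∀ s, u ∉ s → padded A' s = padded A s := fun s hs => by
    ext i j
    simp only [padded, hval]
    grind
  -- minors of `A` containing `u`
  have noneA : ∀ s, u ∈ s → v ∉ s → w ∉ s → (padded A s).det = 0 := fun s hu hv hw => by
    refine det_eq_zero_of_row_eq_zero u fun j => ?_
    simp only [padded]
    grind
  have pivotA : ∀ s x y, (x = v ∧ y = w ∨ x = w ∧ y = v) → u ∈ s → x ∈ s → y ∉ s →
      (padded A s).det = (padded A ((s.erase u).erase x)).det := by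
    clear avoid noneA
    intro s x y hxy hu hx hy
    have hux : u ≠ x := by grind
    refine det_eq_of_pivot hux (fun j => ?_) (fun i => ?_) (fun i j => ?_) <;>
      simp only [padded, Finset.mem_erase] <;> grind
  have bothA : ∀ s, u ∈ s → v ∈ s → w ∈ s →
      (padded A s).det = (padded A' ((s.erase v).erase w)).det := by
    clear avoid noneA pivotA
    intro s hu hv hw
    let M : Matrix V V ℤ := fun i j => padded A s i j +
      (if i = w then (-1) * padded A s v j else 0) +
      (if j = w then (-1) * (padded A s i v + if i = w then (-1) * padded A s v v else 0) else 0)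
    let N : Matrix V V ℤ := fun i j =>
      if i = u ∨ i = v ∨ j = u ∨ j = v then (if i = j then 1 else 0) else M i j
    have e1 : (padded A s).det = M.det := det_add_row_col hvw.symm (-1) fun i j => rfl
    have e2 : M.det = N.det := by
      refine det_eq_of_pivot huv (fun j => ?_) (fun i => ?_) (fun i j => rfl) <;>
        simp only [M, padded] <;> grind
    have e3 : N.det = (padded A' ((s.erase v).erase w)).det := by
      refine det_signed_conj (Equiv.swap u w) (fun i => if i = w then -1 else 1)
        (fun i => by split_ifs <;> rfl) fun i j => ?_
      simp only [N, M, padded, hval, Finset.mem_erase, Equiv.swap_apply_def]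
      by_cases hi : i = u <;> by_cases hi' : i = w <;> by_cases hj : j = u <;>
        by_cases hj' : j = w <;> grind
    rw [e1, e2, e3]
  -- minors of `A'` containing `u`
  have bothA' : ∀ s, u ∈ s → v ∈ s → w ∈ s → (padded A' s).det = 0 := by
    clear avoid noneA pivotA bothA
    intro s hu hv hw
    have e : (padded A' s).det = _ := (det_updateRow_add_smul_self (padded A' s) huv (-1)).symm
    rw [e, ← det_updateRow_add_smul_self _ huw 1]
    refine det_eq_zero_of_row_eq_zero u fun j => ?_
    have hj : padded A' s u j + -1 * padded A' s v j + padded A' s w j = 0 := by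
      simp only [padded, hval]
      grind
    simpa [updateRow_apply, huw.symm] using hj
  have oneA' : ∀ s x y (c : ℤ), (x = v ∧ y = w ∧ c = -1 ∨ x = w ∧ y = v ∧ c = 1) →
      u ∈ s → x ∈ s → y ∉ s →
      (padded A' s).det = (padded A (insert y (s.erase u))).det := by
    clear avoid noneA pivotA bothA bothA'
    intro s x y c hxy hu hx hy
    have hux : u ≠ x := by grind
    let M : Matrix V V ℤ := fun i j => padded A' s i j +
      (if i = u then c * padded A' s x j else 0) +
      (if j = u then c * (padded A' s i x + if i = u then c * padded A' s x x else 0) else 0)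
    have e1 : (padded A' s).det = M.det := det_add_row_col hux c fun i j => rfl
    rw [e1]
    refine det_signed_conj (Equiv.swap u y) (fun i => if i = u then c else 1)
      (fun i => by grind) fun i j => ?_
    simp only [M, padded, hval, Finset.mem_insert, Finset.mem_erase, Equiv.swap_apply_def]
    by_cases hi : i = u <;> by_cases hi' : i = y <;> by_cases hj : j = u <;>
      by_cases hj' : j = y <;> grind
  rw [isPU_iff_det_padded, isPU_iff_det_padded]
  constructor
  · intro H s
    by_cases hu : u ∈ s
    · by_cases hv : v ∈ s <;> by_cases hw : w ∈ s
      · exact Or.inl (bothA' s hu hv hw)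
      · rw [oneA' s v w (-1) (by simp) hu hv hw]; exact H _
      · rw [oneA' s w v 1 (by simp) hu hw hv]; exact H _
      · have := bothA (insert v (insert w s)) (by simp [hu]) (by simp) (by simp)
        have hs : ((insert v (insert w s)).erase v).erase w = s := by
          rw [Finset.erase_insert (by simp [hv, hvw]), Finset.erase_insert hw]
        rw [hs] at this
        rw [← this]; exact H _
    · rw [avoid s hu]; exact H _
  · intro H s
    have H' : ∀ t, u ∉ t → (padded A t).det = 0 ∨ (padded A t).det = 1 := fun t ht => by
      rw [← avoid t ht]; exact H t
    by_cases hu : u ∈ s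
    · by_cases hv : v ∈ s <;> by_cases hw : w ∈ s
      · rw [bothA s hu hv hw]; exact H _
      · rw [pivotA s v w (by simp) hu hv hw]; exact H' _ (by simp)
      · rw [pivotA s w v (by simp) hu hw hv]; exact H' _ (by simp)
      · exact Or.inl (noneA s hu hv hw)
    · exact H' s hu
end

section
/- Let B be an integer matrix (with rows indexed by a finite set I and columns by a finite set J) that is totally unimodular, and suppose B i₀ j₀ = 1 for some i₀ ∈ I, j₀ ∈ J. Define B' by: B' i₀ j₀ = −1; B' i₀ j = B i₀ j for j ≠ j₀; B' i j₀ = B i j₀ for i ≠ i₀; and B' i j = B i j − (B i j₀)·(B i₀ j) for i ≠ i₀ and j ≠ j₀. Then B' is totally unimodular. -/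
open Matrix

/-- An integer matrix is totally unimodular if every minor (determinant of a square
submatrix selected by injective row- and column-choices) lies in `{-1, 0, 1}`. -/
def IsTU {I J : Type*} (B : Matrix I J ℤ) : Prop :=
  ∀ (k : ℕ) (f : Fin k → I) (g : Fin k → J),
    Function.Injective f → Function.Injective g →
    (B.submatrix f g).det ∈ ({-1, 0, 1} : Set ℤ)

/-- Clearing column `b` of `A` by adding multiples of row `a`, then expanding along that column. -/
theorem Matrix.det_eq_mul_det_of_eliminate {R : Type*} [CommRing R] {n : ℕ}
    (A : Matrix (Fin (n + 1)) (Fin (n + 1)) R) (C : Matrix (Fin n) (Fin n) R)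
    (a b : Fin (n + 1)) (c : Fin n → R)
    (hcol : ∀ i, A (a.succAbove i) b + c i * A a b = 0)
    (hC : ∀ i j, C i j = A (a.succAbove i) (b.succAbove j) + c i * A a (b.succAbove j)) :
    A.det = (-1) ^ (a + b : ℕ) * A a b * C.det := by
  let d : Fin (n + 1) → R := a.insertNth 0 c
  have hd : d a = 0 := by simp [d]
  have hda (i : Fin n) : d (a.succAbove i) = c i := by simp [d]
  let N : Matrix (Fin (n + 1)) (Fin (n + 1)) R := of fun i j => A i j + d i * A a j
  have hN : N.det = A.det :=
    det_eq_of_forall_row_eq_smul_add_const d a hd fun _ _ => rfl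
  have hsub : N.submatrix a.succAbove b.succAbove = C := by
    ext i j
    simp [N, hda, hC]
  rw [← hN, det_succ_column N b, Fin.sum_univ_succAbove _ a, Finset.sum_eq_zero, hsub]
  · simp [N, hd]
  · intro i _
    simp [N, hda, hcol]

theorem mul_mem_neg_one_zero_one {x y : ℤ} (hx : x ∈ ({-1, 0, 1} : Set ℤ))
    (hy : y ∈ ({-1, 0, 1} : Set ℤ)) : x * y ∈ ({-1, 0, 1} : Set ℤ) := by
  simp only [Set.mem_insert_iff, Set.mem_singleton_iff] at *
  rcases hx with rfl | rfl | rfl <;> rcases hy with rfl | rfl | rfl <;> simp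

theorem neg_one_pow_mem_neg_one_zero_one (n : ℕ) : (-1 : ℤ) ^ n ∈ ({-1, 0, 1} : Set ℤ) := by
  rcases neg_one_pow_eq_or ℤ n with h | h <;> simp [h]

/-- pivot, move Ω₄ on the bipartite block: pivoting a totally
unimodular integer matrix at an entry equal to `1` yields a totally unimodular
matrix. -/
theorem stmt7 {I J : Type*} [Fintype I] [Fintype J] [DecidableEq I] [DecidableEq J]
    (B B' : Matrix I J ℤ) (hB : IsTU B)
    (i₀ : I) (j₀ : J) (hpivot : B i₀ j₀ = 1)
    (h1 : B' i₀ j₀ = -1)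
    (h2 : ∀ j, j ≠ j₀ → B' i₀ j = B i₀ j)
    (h3 : ∀ i, i ≠ i₀ → B' i j₀ = B i j₀)
    (h4 : ∀ i j, i ≠ i₀ → j ≠ j₀ → B' i j = B i j - B i j₀ * B i₀ j) :
    IsTU B' := by
  intro k f g hf hg
  by_cases hi : ∃ a, f a = i₀
  · obtain ⟨a, rfl⟩ := hi
    have hfa (i) (hia : i ≠ a) : f i ≠ f a := hf.ne hia
    by_cases hj : ∃ b, g b = j₀
    · obtain ⟨b, rfl⟩ := hj
      cases k with
      | zero => exact a.elim0
      | succ n =>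
        rw [det_eq_mul_det_of_eliminate _
          (B.submatrix (f ∘ a.succAbove) (g ∘ b.succAbove)) a b
          (fun i => B (f (a.succAbove i)) (g b))]
        · refine mul_mem_neg_one_zero_one (mul_mem_neg_one_zero_one
            (neg_one_pow_mem_neg_one_zero_one _) (by simp [h1])) (hB _ _ _ ?_ ?_)
          · exact hf.comp Fin.succAbove_right_injective
          · exact hg.comp Fin.succAbove_right_injective
        · intro i
          simp [h1, h3 _ (hfa _ (Fin.succAbove_ne a i))]
        · intro i j
          have hgj : g (b.succAbove j) ≠ g b := hg.ne (Fin.succAbove_ne b j)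
          simp [h4 _ _ (hfa _ (Fin.succAbove_ne a i)) hgj, h2 _ hgj]
    · push Not at hj
      rw [← det_eq_of_forall_row_eq_smul_add_const (A := B.submatrix f g)
        (fun i => if i = a then 0 else B (f i) j₀) a (by simp)]
      · exact hB k f g hf hg
      · intro i j
        by_cases hia : i = a
        · simp [hia, h2 _ (hj j)]
        · simp [hia, h2 _ (hj j), h4 _ _ (hfa i hia) (hj j)]
  · push Not at hi
    by_cases hj : ∃ b, g b = j₀
    · obtain ⟨b, rfl⟩ := hj
      rw [← det_transpose, ← det_eq_of_forall_row_eq_smul_add_const (A := (B.submatrix f g)ᵀ)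
        (fun j => if j = b then 0 else B i₀ (g j)) b (by simp), det_transpose]
      · exact hB k f g hf hg
      · intro j i
        by_cases hjb : j = b
        · simp [hjb, h3 _ (hi i)]
        · simp [hjb, h3 _ (hi i), h4 _ _ (hi i) (hg.ne hjb), mul_comm]
    · push Not at hj
      have key := hB (k + 1) (Fin.cons i₀ f) (Fin.cons j₀ g)
        (Fin.cons_injective_iff.2 ⟨by simpa using hi, hf⟩)
        (Fin.cons_injective_iff.2 ⟨by simpa using hj, hg⟩)
      rw [det_eq_mul_det_of_eliminate _ (B'.submatrix f g) 0 0 (fun i => -B (f i) j₀)] at key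
      · simpa [hpivot] using key
      · simp [hpivot]
      · intro i j
        simp [h4 _ _ (hi i) (hj j), sub_eq_add_neg]
end

section
/- Let V = V₀ ⊔ V₁ be a finite set and A a principally unimodular skew-symmetric integer matrix on V with entries in {−1, 0, 1} and A v w = 0 whenever v, w ∈ V₀ or v, w ∈ V₁. Let k ≥ 2 and let v₁, v₂, …, v₂ₖ be pairwise distinct elements of V forming a chordless cycle: A v_t v_{t+1} ≠ 0 for all t (indices taken modulo 2k), and A v_s v_t = 0 for every pair (s, t) that is not cyclically adjacent. Then the product ∏_{t=1}^{2k} A v_t v_{t+1} equals 1 (i.e., the cycle is even: it has an even number of codirectional edges). -/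
open Matrix

/-- The weight of the `t`-th edge of the cyclic sequence `v 0, …, v (n - 1)`. -/
def cycleWeight {V : Type*} (A : Matrix V V ℤ) (v : ℕ → V) (n t : ℕ) : ℤ :=
  A (v (t % n)) (v ((t + 1) % n))

lemma prod_range_shift_of_periodic (f : ℕ → ℤ) (n : ℕ) (hf : ∀ t, f (t + n) = f t)
    (hne : ∀ t, f t ≠ 0) (a : ℕ) :
    ∏ i ∈ Finset.range n, f (a + i) = ∏ i ∈ Finset.range n, f i := by
  induction a with
  | zero => simp
  | succ a ih =>
    rw [← ih]
    have h := Finset.prod_range_succ (fun i => f (a + i)) n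
    rw [Finset.prod_range_succ', hf] at h
    refine mul_right_cancel₀ (hne a) (Eq.trans ?_ h)
    simp only [add_zero, add_assoc, add_comm 1]

/-- A row of the matrix of a chordless cycle has only two nonzero entries. -/
lemma sum_row_chordless_cycle {V : Type*} (A : Matrix V V ℤ) (hskew : Aᵀ = -A)
    (n : ℕ) (hn : 3 ≤ n) (v : ℕ → V)
    (hchordless : ∀ s t, s < n → t < n → s ≠ t →
      t ≠ (s + 1) % n → s ≠ (t + 1) % n → A (v s) (v t) = 0) (x : ℕ → ℤ) (t : ℕ) :
    ∑ s ∈ Finset.range n, A (v ((t + 1) % n)) (v s) * x s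
      = cycleWeight A v n (t + 1) * x ((t + 2) % n) - cycleWeight A v n t * x (t % n) := by
  have hs : ∀ i j, A j i = -A i j := fun i j => congrFun (congrFun hskew i) j
  have hpos : 0 < n := by omega
  have hne : (t + 2) % n ≠ t % n := by
    intro h
    have h2 : n ∣ t + 2 - t := (Nat.modEq_iff_dvd' (by omega)).1 (Eq.symm h)
    have := Nat.le_of_dvd (by omega) h2
    omega
  rw [Finset.sum_eq_add_of_mem ((t + 2) % n) (t % n) (Finset.mem_range.2 (Nat.mod_lt _ hpos))
    (Finset.mem_range.2 (Nat.mod_lt _ hpos)) hne]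
  · simp only [cycleWeight]
    rw [hs (v (t % n)) (v ((t + 1) % n))]
    ring
  · rintro s hsn ⟨h1, h2⟩
    rw [Finset.mem_range] at hsn
    have hz : A (v ((t + 1) % n)) (v s) = 0 := by
      by_cases h : (t + 1) % n = s
      · have := hs (v s) (v s)
        rw [h]
        omega
      · refine hchordless _ _ (Nat.mod_lt _ hpos) hsn h (by rwa [Nat.mod_add_mod]) ?_
        intro h3
        have h4 : t ≡ s [MOD n] := Nat.ModEq.add_right_cancel' 1 h3
        exact h2 ((Nat.mod_eq_of_lt hsn).symm.trans h4.symm)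
    rw [hz, zero_mul]

/-- If the row relations of a cycle of length `2 * k` have a nonzero solution, the cycle is
even. -/
lemma prod_eq_one_of_row_relations (k : ℕ) (w : ℕ → ℤ) (hw : ∀ t, w t * w t = 1)
    (hper : ∀ t, w (t + 2 * k) = w t) (x : ℕ → ℤ) (a : ℕ) (hxper : x (a + 2 * k) = x a)
    (hxa : x a ≠ 0) (hrel : ∀ t, w (t + 1) * x (t + 2) = w t * x t) :
    ∏ i ∈ Finset.range (2 * k), w i = 1 := by
  have hchain : ∀ m, x (a + 2 * m) = (∏ i ∈ Finset.range (2 * m), w (a + i)) * x a := by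
    intro m
    induction m with
    | zero => simp
    | succ m ih =>
      rw [show 2 * (m + 1) = 2 * m + 1 + 1 by ring, Finset.prod_range_succ,
        Finset.prod_range_succ]
      have h1 := hrel (a + 2 * m)
      have h2 := hw (a + 2 * m + 1)
      rw [ih] at h1
      simp only [← add_assoc]
      linear_combination w (a + 2 * m + 1) * h1 - x (a + 2 * m + 2) * h2
  have hne : ∀ t, w t ≠ 0 := fun t h => by simpa [h] using hw t
  have h := hchain k
  rw [hxper, prod_range_shift_of_periodic w _ hper hne] at h
  exact mul_right_cancel₀ hxa (by rw [one_mul]; exact h.symm)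

/-- in a principally unimodular bipartite skew-symmetric `±1/0` matrix,
every chordless cycle `v 0, v 1, …, v (2k-1)` (of length `2k ≥ 4`) is even:
`∏_{t<2k} A (v t) (v ((t+1) mod 2k)) = 1`. -/
theorem stmt9 {V₀ V₁ : Type*} [Fintype V₀] [Fintype V₁] [DecidableEq V₀] [DecidableEq V₁]
    (A : Matrix (V₀ ⊕ V₁) (V₀ ⊕ V₁) ℤ) (hskew : Aᵀ = -A)
    (hent : ∀ i j, A i j ∈ ({-1, 0, 1} : Set ℤ))
    (hbip₀ : ∀ i j : V₀, A (Sum.inl i) (Sum.inl j) = 0)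
    (hbip₁ : ∀ i j : V₁, A (Sum.inr i) (Sum.inr j) = 0)
    (hPU : ∀ s : Finset (V₀ ⊕ V₁),
      (A.submatrix (Subtype.val : {x // x ∈ s} → (V₀ ⊕ V₁)) Subtype.val).det
        ∈ ({0, 1} : Set ℤ))
    (k : ℕ) (hk : 2 ≤ k) (v : ℕ → V₀ ⊕ V₁)
    (hinj : ∀ s t, s < 2 * k → t < 2 * k → v s = v t → s = t)
    (hadj : ∀ t, t < 2 * k → A (v t) (v ((t + 1) % (2 * k))) ≠ 0)
    (hchordless : ∀ s t, s < 2 * k → t < 2 * k → s ≠ t →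
      t ≠ (s + 1) % (2 * k) → s ≠ (t + 1) % (2 * k) → A (v s) (v t) = 0) :
    ∏ t ∈ Finset.range (2 * k), A (v t) (v ((t + 1) % (2 * k))) = 1 := by
  have hn : 0 < 2 * k := by omega
  have hw : ∀ t, cycleWeight A v (2 * k) t * cycleWeight A v (2 * k) t = 1 := by
    intro t
    have h1 := hent (v (t % (2 * k))) (v ((t + 1) % (2 * k)))
    have h2 := hadj (t % (2 * k)) (Nat.mod_lt _ hn)
    rw [Nat.mod_add_mod] at h2
    simp only [Set.mem_insert_iff, Set.mem_singleton_iff] at h1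
    unfold cycleWeight
    rcases h1 with h | h | h
    · rw [h]; norm_num
    · exact absurd h h2
    · rw [h]; norm_num
  let u : Fin (2 * k) → V₀ ⊕ V₁ := fun i => v i
  have hu : Function.Injective u := fun i j h => Fin.ext (hinj i j i.2 j.2 h)
  set M : Matrix (Fin (2 * k)) (Fin (2 * k)) ℤ := A.submatrix u u with hM
  have hrow : ∀ (x : ℕ → ℤ) (t : ℕ),
      (M *ᵥ fun i => x i) ⟨(t + 1) % (2 * k), Nat.mod_lt _ hn⟩
        = cycleWeight A v (2 * k) (t + 1) * x ((t + 2) % (2 * k))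
          - cycleWeight A v (2 * k) t * x (t % (2 * k)) := by
    intro x t
    rw [← sum_row_chordless_cycle A hskew (2 * k) (by omega) v hchordless x t]
    exact Fin.sum_univ_eq_sum_range (fun s => A (v ((t + 1) % (2 * k))) (v s) * x s) (2 * k)
  have hdet01 : M.det = 0 ∨ M.det = 1 := by
    have h := hPU (Finset.univ.map ⟨u, hu⟩)
    let e : Fin (2 * k) ≃ {x // x ∈ Finset.univ.map ⟨u, hu⟩} :=
      Equiv.ofBijective (fun i => ⟨u i, by simp⟩)
        ⟨fun i j hij => hu (congrArg Subtype.val hij), by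
          rintro ⟨y, hy⟩
          obtain ⟨i, -, rfl⟩ := Finset.mem_map.1 hy
          exact ⟨i, rfl⟩⟩
    rw [← Matrix.det_submatrix_equiv_self e, Matrix.submatrix_submatrix] at h
    exact h
  have hsurj : ∀ i : Fin (2 * k), ∃ t,
      (⟨(t + 1) % (2 * k), Nat.mod_lt _ hn⟩ : Fin (2 * k)) = i := by
    intro i
    refine ⟨i + (2 * k - 1), Fin.ext ?_⟩
    have h : (i : ℕ) + (2 * k - 1) + 1 = i + 2 * k := by omega
    simp only [h, Nat.add_mod_right, Nat.mod_eq_of_lt i.2]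
  have hdet2 : ((M.det : ℤ) : ZMod 2) = 0 := by
    have hmap : ((M.det : ℤ) : ZMod 2) = (M.map (Int.castRingHom (ZMod 2))).det :=
      RingHom.map_det (Int.castRingHom (ZMod 2)) M
    rw [hmap]
    refine Matrix.exists_mulVec_eq_zero_iff.1 ⟨fun _ => 1, ?_, ?_⟩
    · exact fun h => one_ne_zero (congrFun h ⟨0, hn⟩)
    · funext i
      obtain ⟨t, rfl⟩ := hsurj i
      have h1 := congrArg (Int.castRingHom (ZMod 2)) (hrow (fun _ => 1) t)
      rw [RingHom.map_mulVec] at h1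
      have hodd : ∀ t, Int.castRingHom (ZMod 2) (cycleWeight A v (2 * k) t) = 1 := by
        intro t
        rcases mul_self_eq_one_iff.1 (hw t) with h | h <;> rw [h]
        · simp
        · decide
      simp only [mul_one, map_sub, hodd, sub_self] at h1
      rw [Pi.zero_apply, ← h1]
      congr 2
  have hdet : M.det = 0 := by
    rcases hdet01 with h | h
    · exact h
    · rw [h] at hdet2
      exact absurd hdet2 (by decide)
  obtain ⟨x, hx0, hx⟩ := Matrix.exists_mulVec_eq_zero_iff.2 hdet
  obtain ⟨i, hi⟩ := Function.ne_iff.1 hx0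
  let y : ℕ → ℤ := fun t => x ⟨t % (2 * k), Nat.mod_lt _ hn⟩
  have hy : (fun i : Fin (2 * k) => y i) = x := by
    funext j
    exact congrArg x (Fin.ext (Nat.mod_eq_of_lt j.2))
  have hprod := prod_eq_one_of_row_relations k (cycleWeight A v (2 * k)) hw
    (fun t => by
      simp only [cycleWeight, Nat.add_mod_right, add_right_comm t (2 * k) 1])
    y i (by simp only [y, Nat.add_mod_right]) (by rw [congrFun hy i]; exact hi)
    (fun t => by
      have h := hrow y t
      rw [hy, hx, Pi.zero_apply] at h
      simp only [y, Nat.mod_mod] at h ⊢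
      linarith)
  rw [← hprod]
  refine Finset.prod_congr rfl fun t ht => ?_
  rw [cycleWeight, Nat.mod_eq_of_lt (Finset.mem_range.1 ht)]
end

section
/- Let V = V₀ ⊔ V₁ be a finite set and let A and A' be two skew-symmetric integer matrices on V, each with entries in {−1, 0, 1}, vanishing on V₀ × V₀ and V₁ × V₁, both principally unimodular, and with the same support (A v w = 0 if and only if A' v w = 0 for all v, w). Then there exists ε : V → {−1, 1} such that A' v w = ε(v) · (A v w) · ε(w) for all v, w ∈ V. -/
open Matrix

/-- The candidate kernel vector of the skew-symmetric matrix `A` along the path `p`. -/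
def pathKernel {V : Type*} (A : Matrix V V ℤ) (p : ℕ → V) : ℕ → ℤ
  | 0 => 1
  | 1 => 0
  | i + 2 => -(A (p (i + 1)) (p i) * A (p (i + 1)) (p (i + 2))) * pathKernel A p i

/-- Principal unimodularity, for submatrices along injective maps. -/
lemma det_submatrix_mem_of_injective {V ι : Type*} [DecidableEq V] [Fintype ι] [DecidableEq ι]
    {A : Matrix V V ℤ}
    (hPU : ∀ s : Finset V,
      (A.submatrix (Subtype.val : {x // x ∈ s} → V) Subtype.val).det ∈ ({0, 1} : Set ℤ))
    {f : ι → V} (hf : Function.Injective f) : (A.submatrix f f).det ∈ ({0, 1} : Set ℤ) := by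
  let e : ι ≃ {x // x ∈ Finset.univ.image f} :=
    Equiv.ofBijective (fun i => ⟨f i, by simp⟩)
      ⟨fun i j h => hf (congrArg Subtype.val h), fun ⟨x, hx⟩ => by
        obtain ⟨i, -, rfl⟩ := Finset.mem_image.1 hx
        exact ⟨i, rfl⟩⟩
  have h := hPU (Finset.univ.image f)
  rw [← Matrix.det_submatrix_equiv_self e, Matrix.submatrix_submatrix] at h
  exact h

lemma pathKernel_odd {V : Type*} (A : Matrix V V ℤ) (p : ℕ → V) (k : ℕ) :
    pathKernel A p (2 * k + 1) = 0 := by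
  induction k with
  | zero => rfl
  | succ k ih =>
    rw [show 2 * (k + 1) + 1 = 2 * k + 1 + 2 by ring, pathKernel, ih, mul_zero]

lemma eq_one_or_neg_one_of_mem {a : ℤ} (h : a ∈ ({-1, 0, 1} : Set ℤ)) (h0 : a ≠ 0) :
    a = 1 ∨ a = -1 := by
  rcases h with h | h | h
  · exact Or.inr h
  · exact absurd h h0
  · exact Or.inl h

section InducedCycle

variable {V : Type*} {A : Matrix V V ℤ} {p : ℕ → V} {m : ℕ}

lemma pathKernel_even (hent : ∀ i j, A i j ∈ ({-1, 0, 1} : Set ℤ)) (hskew : ∀ i j, A i j = -A j i)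
    (hadj : ∀ i < m, A (p i) (p (i + 1)) ≠ 0) (k : ℕ) (hk : 2 * k ≤ m) :
    pathKernel A p (2 * k) = 1 ∨ pathKernel A p (2 * k) = -1 := by
  induction k with
  | zero => exact Or.inl rfl
  | succ k ih =>
    rw [show 2 * (k + 1) = 2 * k + 2 by ring, pathKernel, hskew (p (2 * k + 1)) (p (2 * k))]
    rcases eq_one_or_neg_one_of_mem (hent _ _) (hadj (2 * k) (by omega)) with h | h <;>
    rcases eq_one_or_neg_one_of_mem (hent _ _) (hadj (2 * k + 1) (by omega)) with h' | h' <;>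
    rcases ih (by omega) with h'' | h'' <;>
    simp [h, h', h'']

/-- A row of an interior vertex of an induced path has two nonzero entries. -/
lemma sum_row_interior (hchord : ∀ i j, i < j → j ≤ m → j ≠ i + 1 → A (p i) (p j) = 0)
    (hskew : ∀ i j, A i j = -A j i) (y : ℕ → ℤ) (i : ℕ) (hi : i + 2 ≤ m) :
    ∑ k ∈ Finset.range (m + 1), A (p (i + 1)) (p k) * y k =
      A (p (i + 1)) (p i) * y i + A (p (i + 1)) (p (i + 2)) * y (i + 2) := by
  refine Finset.sum_eq_add i (i + 2) (by omega) ?_ ?_ ?_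
  · rintro k hk ⟨h1, h2⟩
    rw [Finset.mem_range] at hk
    rcases lt_trichotomy k (i + 1) with h | h | h
    · rw [hskew, hchord k (i + 1) h (by omega) (by omega)]; simp
    · have := hskew (p (i + 1)) (p (i + 1))
      rw [h, show A (p (i + 1)) (p (i + 1)) = 0 by omega, zero_mul]
    · rw [hchord _ _ h (by omega) (by omega), zero_mul]
  · intro h; simp at h; omega
  · intro h; simp at h; omega

lemma sum_row_first (hchord : ∀ i j, i < j → j ≤ m → j ≠ i + 1 → A (p i) (p j) = 0)
    (hskew : ∀ i j, A i j = -A j i) (y : ℕ → ℤ) (hm : 1 ≤ m) :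
    ∑ k ∈ Finset.range (m + 1), A (p 0) (p k) * y k = A (p 0) (p 1) * y 1 := by
  refine Finset.sum_eq_single 1 ?_ ?_
  · intro k hk h1
    rw [Finset.mem_range] at hk
    rcases Nat.eq_zero_or_pos k with h | h
    · have := hskew (p 0) (p 0)
      rw [h, show A (p 0) (p 0) = 0 by omega, zero_mul]
    · rw [hchord _ _ h (by omega) (by omega), zero_mul]
  · intro h; simp at h; omega

lemma sum_row_last (hchord : ∀ i j, i < j → j ≤ m + 1 → j ≠ i + 1 → A (p i) (p j) = 0)
    (hskew : ∀ i j, A i j = -A j i) (y : ℕ → ℤ) :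
    ∑ k ∈ Finset.range (m + 2), A (p (m + 1)) (p k) * y k = A (p (m + 1)) (p m) * y m := by
  refine Finset.sum_eq_single m ?_ ?_
  · intro k hk h1
    rw [Finset.mem_range] at hk
    rcases Nat.lt_or_ge k (m + 1) with h | h
    · rw [hskew, hchord k (m + 1) h (by omega) (by omega)]; simp
    · have := hskew (p (m + 1)) (p (m + 1))
      rw [show k = m + 1 by omega, show A (p (m + 1)) (p (m + 1)) = 0 by omega, zero_mul]
  · intro h; simp at h

lemma sum_row_apex {v : V} (hv : ∀ i, 0 < i → i < m → A v (p i) = 0) (hm : 1 ≤ m) (y : ℕ → ℤ) :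
    ∑ k ∈ Finset.range (m + 1), A v (p k) * y k = A v (p 0) * y 0 + A v (p m) * y m := by
  refine Finset.sum_eq_add 0 m (by omega) ?_ ?_ ?_
  · rintro k hk ⟨h1, h2⟩
    rw [Finset.mem_range] at hk
    rw [hv k (by omega) (by omega), zero_mul]
  · intro h; simp at h
  · intro h; simp at h

/-- In a principally unimodular matrix, the signs along an induced even cycle are constrained. -/
lemma apex_add_pathKernel_eq_zero [DecidableEq V]
    (hPU : ∀ s : Finset V,
      (A.submatrix (Subtype.val : {x // x ∈ s} → V) Subtype.val).det ∈ ({0, 1} : Set ℤ))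
    (hent : ∀ i j, A i j ∈ ({-1, 0, 1} : Set ℤ)) (hskew : ∀ i j, A i j = -A j i) {v : V}
    (hm : 1 ≤ m) (heven : Even m)
    (hinj : ∀ i j, i < j → j ≤ m → p i ≠ p j) (hpv : ∀ i ≤ m, p i ≠ v)
    (hadj : ∀ i < m, A (p i) (p (i + 1)) ≠ 0)
    (hchord : ∀ i j, i < j → j ≤ m → j ≠ i + 1 → A (p i) (p j) = 0)
    (hv : ∀ i, 0 < i → i < m → A v (p i) = 0) (hv0 : A v (p 0) ≠ 0) (hvm : A v (p m) ≠ 0) :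
    A v (p 0) + A v (p m) * pathKernel A p m = 0 := by
  by_contra hc
  obtain ⟨n, hn⟩ := heven
  have hsq : ∀ i < m, A (p i) (p (i + 1)) * A (p i) (p (i + 1)) = 1 := fun i hi => by
    rcases eq_one_or_neg_one_of_mem (hent _ _) (hadj i hi) with h | h <;> simp [h]
  set c := A v (p 0) + A v (p m) * pathKernel A p m with hcdef
  have hc2 : (2 : ℤ) ∣ c := by
    have hz := pathKernel_even hent hskew hadj n (by omega)
    rw [show 2 * n = m by omega] at hz
    rcases eq_one_or_neg_one_of_mem (hent _ _) hv0 with h | h <;>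
    rcases eq_one_or_neg_one_of_mem (hent _ _) hvm with h' | h' <;>
    rcases hz with h'' | h'' <;>
    simp [hcdef, h, h', h'']
  let f : Option (Fin (m + 1)) → V := fun o => o.elim v (fun k => p k)
  have hf : Function.Injective f := by
    rintro (_ | i) (_ | j) h
    · rfl
    · exact absurd h.symm (hpv j (by omega))
    · exact absurd h (hpv i (by omega))
    · rcases lt_trichotomy i j with hij | hij | hij
      · exact absurd h (hinj i j hij (by omega))
      · rw [hij]
      · exact absurd h.symm (hinj j i hij (by omega))
  set M := A.submatrix f f with hM
  have hrow : ∀ (t : ℤ) (y : ℕ → ℤ) (o : Option (Fin (m + 1))),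
      (M *ᵥ fun o => o.elim t (fun k => y k)) o =
        A (f o) v * t + ∑ k ∈ Finset.range (m + 1), A (f o) (p k) * y k := fun t y o => by
    rw [Finset.sum_range]
    simp [Matrix.mulVec, dotProduct, Fintype.sum_option, hM, f]
  let z : Option (Fin (m + 1)) → ℤ := fun o => o.elim 0 (fun k => pathKernel A p k)
  have hz : M *ᵥ z = Pi.single none c := by
    ext o
    rw [hrow]
    rcases o with _ | ⟨i, hi⟩
    · change _ * _ + ∑ k ∈ _, A v (p k) * _ = _
      rw [sum_row_apex hv hm]
      simp [hcdef, pathKernel]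
    · change _ * _ + ∑ k ∈ _, A (p i) (p k) * _ = _
      rw [Pi.single_eq_of_ne (by simp), mul_zero, zero_add]
      rcases i with _ | i
      · rw [sum_row_first hchord hskew _ hm, pathKernel, mul_zero]
      · rcases Nat.lt_or_ge (i + 1) m with h | h
        · rw [sum_row_interior hchord hskew _ i h, pathKernel]
          linear_combination -(A (p (i + 1)) (p i) * pathKernel A p i) * hsq (i + 1) h
        · obtain rfl : m = i + 1 := by omega
          rw [sum_row_last hchord hskew, show i = 2 * (n - 1) + 1 by omega, pathKernel_odd,
            mul_zero]
  have hdet : M.det = 0 := by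
    rcases det_submatrix_mem_of_injective hPU hf with h | h
    · exact h
    exfalso
    have h1 : M.adjugate *ᵥ (M *ᵥ z) = z := by
      rw [Matrix.mulVec_mulVec, Matrix.adjugate_mul]
      change (A.submatrix f f).det = 1 at h
      rw [← hM] at h
      simp [h]
    have h2 := congrFun h1 (some 0)
    rw [hz, Matrix.mulVec_single] at h2
    simp [z, pathKernel] at h2
    have : (2 : ℤ) ∣ 1 := h2 ▸ (hc2.mul_left _)
    omega
  obtain ⟨y, hy0, hy⟩ := Matrix.exists_mulVec_eq_zero_iff.2 hdet
  have hyv : y none = 0 := by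
    have h1 : z ⬝ᵥ (M *ᵥ y) = 0 := by simp [hy]
    have hMT : Mᵀ = -M := by ext i j; exact hskew _ _
    rw [Matrix.dotProduct_mulVec, ← Matrix.mulVec_transpose, hMT, Matrix.neg_mulVec, hz] at h1
    simpa [hc] using h1
  let Y : ℕ → ℤ := fun k => if h : k < m + 1 then y (some ⟨k, h⟩) else 0
  have hyY : y = fun o => o.elim 0 (fun k => Y k) := by
    ext (_ | k)
    · exact hyv
    · change y (some k) = Y k
      simp only [Y, dif_pos k.isLt]
  have hker : ∀ o, ∑ k ∈ Finset.range (m + 1), A (f o) (p k) * Y k = 0 := fun o => by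
    have := hrow 0 Y o
    rw [← hyY, hy] at this
    simpa using this.symm
  have hYi : ∀ i, i ≤ m → Y i = Y 0 * pathKernel A p i := by
    intro i
    induction i using Nat.twoStepInduction with
    | zero => simp [pathKernel]
    | one =>
      intro _
      have h := hker (some 0)
      change ∑ k ∈ _, A (p 0) (p k) * _ = _ at h
      rw [sum_row_first hchord hskew _ hm] at h
      simpa [pathKernel, hadj 0 (by omega)] using h
    | more i ih _ =>
      intro hi
      have h := hker (some ⟨i + 1, by omega⟩)
      change ∑ k ∈ _, A (p (i + 1)) (p k) * _ = _ at h
      rw [sum_row_interior hchord hskew _ i hi, ih (by omega)] at h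
      rw [pathKernel]
      linear_combination A (p (i + 1)) (p (i + 2)) * h - Y (i + 2) * hsq (i + 1) (by omega)
  have hY0 : Y 0 = 0 := by
    have h := hker none
    change ∑ k ∈ _, A v (p k) * _ = _ at h
    rw [sum_row_apex hv hm, hYi m le_rfl] at h
    have : Y 0 * c = 0 := by rw [hcdef]; linear_combination h
    simpa [hc] using this
  apply hy0
  rw [hyY]
  ext (_ | k)
  · rfl
  · simp [hYi k (by omega), hY0]

end InducedCycle

/-- If `A` and `A'` agree up to the signs `ε` on `S`, then the sign discrepancies of the row of `v`
agree at the two ends of every walk in `S`. -/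
lemma discrepancy_eq_of_walk {V : Type*} [DecidableEq V] {A A' : Matrix V V ℤ}
    (hskew : ∀ i j, A i j = -A j i) (hskew' : ∀ i j, A' i j = -A' j i)
    (hent : ∀ i j, A i j ∈ ({-1, 0, 1} : Set ℤ)) (hent' : ∀ i j, A' i j ∈ ({-1, 0, 1} : Set ℤ))
    {side : V → Bool} (hside : ∀ i j, A i j ≠ 0 → side i ≠ side j)
    (hPU : ∀ s : Finset V,
      (A.submatrix (Subtype.val : {x // x ∈ s} → V) Subtype.val).det ∈ ({0, 1} : Set ℤ))
    (hPU' : ∀ s : Finset V,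
      (A'.submatrix (Subtype.val : {x // x ∈ s} → V) Subtype.val).det ∈ ({0, 1} : Set ℤ))
    (hsupp : ∀ v w, A v w = 0 ↔ A' v w = 0) {S : Finset V} {v : V} (hvS : v ∉ S)
    {ε : V → ℤ} (hε : ∀ w, ε w = 1 ∨ ε w = -1)
    (hS : ∀ x ∈ S, ∀ y ∈ S, A' x y = ε x * A x y * ε y) (m : ℕ) :
    ∀ p : ℕ → V, (∀ i ≤ m, p i ∈ S) → (∀ i < m, A (p i) (p (i + 1)) ≠ 0) →
      A v (p 0) ≠ 0 → A v (p m) ≠ 0 →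
      A v (p 0) * A' v (p 0) * ε (p 0) = A v (p m) * A' v (p m) * ε (p m) := by
  have hεε : ∀ w, ε w * ε w = 1 := fun w => by rcases hε w with h | h <;> simp [h]
  induction m using Nat.strong_induction_on with
  | _ m ih =>
  intro p hpS hadj hv0 hvm
  rcases Nat.eq_zero_or_pos m with rfl | hm
  · rfl
  by_cases hv : ∃ i, 0 < i ∧ i < m ∧ A v (p i) ≠ 0
  · obtain ⟨i, hi0, him, hvi⟩ := hv
    refine (ih i him p (fun k hk => hpS k (by omega)) (fun k hk => hadj k (by omega))
      hv0 hvi).trans ?_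
    have h := ih (m - i) (by omega) (fun k => p (i + k)) (fun k hk => hpS _ (by omega))
      (fun k hk => hadj (i + k) (by omega)) hvi
      (by simpa only [show i + (m - i) = m by omega] using hvm)
    simpa only [add_zero, show i + (m - i) = m by omega] using h
  push Not at hv
  by_cases hchord : ∃ i j, i < j ∧ j ≤ m ∧ j ≠ i + 1 ∧ A (p i) (p j) ≠ 0
  · obtain ⟨i, j, hij, hjm, hne, hA⟩ := hchord
    have hlast : ¬ m - (j - i - 1) ≤ i := by omega
    have hend : m - (j - i - 1) + (j - i - 1) = m := by omega
    have h := ih (m - (j - i - 1)) (by omega)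
      (fun k => if k ≤ i then p k else p (k + (j - i - 1)))
      (fun k hk => by split_ifs <;> exact hpS _ (by omega))
      (fun k hk => by
        rcases lt_trichotomy k i with h | h | h
        · rw [if_pos h.le, if_pos (by omega)]
          exact hadj k (by omega)
        · rw [if_pos h.le, if_neg (by omega), show k + 1 + (j - i - 1) = j by omega, h]
          exact hA
        · rw [if_neg (by omega), if_neg (by omega), show k + 1 + (j - i - 1) =
            k + (j - i - 1) + 1 by omega]
          exact hadj _ (by omega))
      (by simpa using hv0) (by simpa only [if_neg hlast, hend] using hvm)
    simpa only [if_neg hlast, hend, Nat.zero_le, if_true] using h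
  push Not at hchord
  by_cases h0m : p 0 = p m
  · rw [h0m]
  have hinj : ∀ i j, i < j → j ≤ m → p i ≠ p j := by
    intro i j hij hjm hp
    rcases hjm.lt_or_eq with h | rfl
    · exact hadj j h (hp ▸ hchord i (j + 1) (by omega) h (by omega))
    · rcases Nat.eq_zero_or_pos i with rfl | hi
      · exact h0m hp
      · exact hvm (hp ▸ hv i hi hij)
  have hpv : ∀ i ≤ m, p i ≠ v := fun i hi h => hvS (h ▸ hpS i hi)
  have hparity : ∀ i ≤ m, (side (p i) = side (p 0) ↔ Even i) := by
    intro i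
    induction i with
    | zero => simp
    | succ i ihi =>
      intro hi
      have h1 := ihi (by omega)
      have h2 := hside _ _ (hadj i hi)
      rw [Nat.even_add_one, ← h1]
      revert h2
      cases side (p i) <;> cases side (p (i + 1)) <;> cases side (p 0) <;> simp
  have heven : Even m := by
    rw [← hparity m le_rfl]
    have h1 := hside _ _ hv0
    have h2 := hside _ _ hvm
    revert h1 h2
    cases side v <;> cases side (p m) <;> cases side (p 0) <;> simp
  have hK : ∀ i ≤ m, pathKernel A' p i = ε (p 0) * ε (p i) * pathKernel A p i := by
    intro i
    induction i using Nat.twoStepInduction with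
    | zero => simp [pathKernel, hεε]
    | one => simp [pathKernel]
    | more i ihi _ =>
      intro hi
      rw [pathKernel, pathKernel, ihi (by omega),
        hS _ (hpS _ (by omega)) _ (hpS _ (by omega)),
        hS _ (hpS (i + 1) (by omega)) _ (hpS (i + 2) (by omega))]
      rcases hε (p i) with h | h <;> rcases hε (p (i + 1)) with h' | h' <;>
      rw [h, h'] <;> ring
  have hA := apex_add_pathKernel_eq_zero hPU hent hskew hm heven hinj hpv hadj hchord hv hv0 hvm
  have hA' := apex_add_pathKernel_eq_zero hPU' hent' hskew' (v := v) hm heven hinj hpv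
    (fun i hi => (hsupp _ _).not.1 (hadj i hi))
    (fun i j h1 h2 h3 => (hsupp _ _).1 (hchord i j h1 h2 h3))
    (fun i h1 h2 => (hsupp _ _).1 (hv i h1 h2)) ((hsupp _ _).not.1 hv0) ((hsupp _ _).not.1 hvm)
  rw [hK m le_rfl] at hA'
  obtain ⟨n, hn⟩ := heven
  have hz := pathKernel_even hent hskew hadj n (by omega)
  rw [show 2 * n = m by omega] at hz
  rw [eq_neg_of_add_eq_zero_left hA, eq_neg_of_add_eq_zero_left hA']
  rcases hz with h | h <;> rcases hε (p 0) with h' | h' <;> rw [h, h'] <;> ring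

/-- Every chain of a relation is traced by a sequence. -/
lemma exists_walk_of_reflTransGen {V : Type*} {r : V → V → Prop} {a b : V}
    (h : Relation.ReflTransGen r a b) :
    ∃ (m : ℕ) (p : ℕ → V), p 0 = a ∧ p m = b ∧ ∀ i < m, r (p i) (p (i + 1)) := by
  induction h using Relation.ReflTransGen.head_induction_on with
  | refl => exact ⟨0, fun _ => b, rfl, rfl, by simp⟩
  | @head a c hac _ ih =>
    obtain ⟨m, p, rfl, hm, hp⟩ := ih
    refine ⟨m + 1, fun k => Nat.casesOn k a p, rfl, hm, ?_⟩
    rintro (_ | i) hi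
    · exact hac
    · exact hp i (by omega)

/-- Uniqueness of principally unimodular signings of a bipartite graph, on a finite set of
vertices. -/
lemma exists_signs_on {V : Type*} [DecidableEq V] {A A' : Matrix V V ℤ}
    (hskew : ∀ i j, A i j = -A j i) (hskew' : ∀ i j, A' i j = -A' j i)
    (hent : ∀ i j, A i j ∈ ({-1, 0, 1} : Set ℤ)) (hent' : ∀ i j, A' i j ∈ ({-1, 0, 1} : Set ℤ))
    {side : V → Bool} (hside : ∀ i j, A i j ≠ 0 → side i ≠ side j)
    (hPU : ∀ s : Finset V,
      (A.submatrix (Subtype.val : {x // x ∈ s} → V) Subtype.val).det ∈ ({0, 1} : Set ℤ))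
    (hPU' : ∀ s : Finset V,
      (A'.submatrix (Subtype.val : {x // x ∈ s} → V) Subtype.val).det ∈ ({0, 1} : Set ℤ))
    (hsupp : ∀ v w, A v w = 0 ↔ A' v w = 0) (S : Finset V) :
    ∃ ε : V → ℤ, (∀ v, ε v = 1 ∨ ε v = -1) ∧
      ∀ x ∈ S, ∀ y ∈ S, A' x y = ε x * A x y * ε y := by
  induction S using Finset.induction_on with
  | empty => exact ⟨fun _ => 1, fun _ => Or.inl rfl, by simp⟩
  | insert v S hvS ih =>
  obtain ⟨ε, hε, hS⟩ := ih
  let r : V → V → Prop := fun x y => x ∈ S ∧ y ∈ S ∧ A x y ≠ 0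
  have hr : ∀ x y, r x y → r y x := fun x y ⟨hx, hy, h⟩ =>
    ⟨hy, hx, fun h' => h (by rw [hskew, h', neg_zero])⟩
  let τ : V → ℤ := fun u => A v u * A' v u * ε u
  have hτ : ∀ u w, u ∈ S → Relation.ReflTransGen r u w → A v u ≠ 0 → A v w ≠ 0 → τ u = τ w := by
    intro u w hu huw hvu hvw
    obtain ⟨m, p, rfl, rfl, hp⟩ := exists_walk_of_reflTransGen huw
    refine discrepancy_eq_of_walk hskew hskew' hent hent' hside hPU hPU' hsupp hvS hε hS m p
      ?_ (fun i hi => (hp i hi).2.2) hvu hvw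
    rintro (_ | i) hi
    · exact hu
    · exact (hp i hi).2.1
  let P : V → Prop := fun w => ∃ u, Relation.ReflTransGen r w u ∧ A v u ≠ 0 ∧ τ u = -1
  have hP : ∀ x y, r x y → (P x ↔ P y) := fun x y h =>
    ⟨fun ⟨u, hu, h'⟩ => ⟨u, hu.head (hr _ _ h), h'⟩, fun ⟨u, hu, h'⟩ => ⟨u, hu.head h, h'⟩⟩
  classical
  let δ : V → ℤ := fun w => if P w then -1 else 1
  have hδ : ∀ w, δ w = 1 ∨ δ w = -1 := fun w => by
    by_cases h : P w <;> simp [δ, h]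
  have hδv : ∀ w ∈ S, A v w ≠ 0 → δ w = τ w := by
    intro w hw hvw
    by_cases h : P w
    · obtain ⟨u, hu, hvu, hτu⟩ := id h
      rw [hτ w u hw hu hvw hvu, hτu]
      exact if_pos h
    · have hne : τ w ≠ -1 := fun h' => h ⟨w, .refl, hvw, h'⟩
      have h1 : τ w = 1 ∨ τ w = -1 := by
        rcases eq_one_or_neg_one_of_mem (hent _ _) hvw with h | h <;>
        rcases eq_one_or_neg_one_of_mem (hent' _ _) ((hsupp _ _).not.1 hvw) with h' | h' <;>
        rcases hε w with h'' | h'' <;>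
        simp [τ, h, h', h'']
      rw [h1.resolve_right hne]
      exact if_neg h
  let η : V → ℤ := fun w => if w = v then 1 else ε w * δ w
  have hηv : η v = 1 := if_pos rfl
  have hηS : ∀ w ∈ S, η w = ε w * δ w := fun w hw => if_neg (by rintro rfl; exact hvS hw)
  have hrow : ∀ w ∈ S, A' v w = η v * A v w * η w := by
    intro w hw
    rw [hηv, hηS w hw]
    by_cases h : A v w = 0
    · rw [h, (hsupp _ _).1 h]; ring
    · rw [hδv w hw h]
      rcases eq_one_or_neg_one_of_mem (hent _ _) h with h | h <;>
      rcases hε w with h'' | h'' <;>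
      simp [τ, h, h'']
  refine ⟨η, fun w => ?_, fun x hx y hy => ?_⟩
  · by_cases h : w = v
    · simp [η, h]
    · rcases hε w with h1 | h1 <;> rcases hδ w with h2 | h2 <;> simp [η, h, h1, h2]
  rcases Finset.mem_insert.1 hx with hxv | hxS <;> rcases Finset.mem_insert.1 hy with hyv | hyS
  · have h := hskew v v
    have h' := hskew' v v
    rw [hxv, hyv, show A v v = 0 by omega, show A' v v = 0 by omega]; ring
  · rw [hxv, hrow y hyS]
  · rw [hyv, hskew', hrow x hxS, hskew x v]; ring
  · rw [hS x hxS y hyS, hηS x hxS, hηS y hyS]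
    by_cases h : A x y = 0
    · rw [h]; ring
    · have hxy : δ x = δ y := by simp only [δ, hP x y ⟨hxS, hyS, h⟩]
      rw [hxy]
      rcases hδ y with h | h <;> rw [h] <;> ring

/-- two principally unimodular skew-symmetric bipartite `±1/0` matrices
with the same support differ by conjugation with a diagonal `±1` matrix:
`A' v w = ε v · A v w · ε w`. -/
theorem stmt10 {V₀ V₁ : Type*} [Fintype V₀] [Fintype V₁] [DecidableEq V₀] [DecidableEq V₁]
    (A A' : Matrix (V₀ ⊕ V₁) (V₀ ⊕ V₁) ℤ)
    (hskew : Aᵀ = -A) (hskew' : A'ᵀ = -A')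
    (hent : ∀ i j, A i j ∈ ({-1, 0, 1} : Set ℤ))
    (hent' : ∀ i j, A' i j ∈ ({-1, 0, 1} : Set ℤ))
    (hbip₀ : ∀ i j : V₀, A (Sum.inl i) (Sum.inl j) = 0)
    (hbip₁ : ∀ i j : V₁, A (Sum.inr i) (Sum.inr j) = 0)
    (hbip₀' : ∀ i j : V₀, A' (Sum.inl i) (Sum.inl j) = 0)
    (hbip₁' : ∀ i j : V₁, A' (Sum.inr i) (Sum.inr j) = 0)
    (hPU : ∀ s : Finset (V₀ ⊕ V₁),
      (A.submatrix (Subtype.val : {x // x ∈ s} → (V₀ ⊕ V₁)) Subtype.val).det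
        ∈ ({0, 1} : Set ℤ))
    (hPU' : ∀ s : Finset (V₀ ⊕ V₁),
      (A'.submatrix (Subtype.val : {x // x ∈ s} → (V₀ ⊕ V₁)) Subtype.val).det
        ∈ ({0, 1} : Set ℤ))
    (hsupp : ∀ v w, A v w = 0 ↔ A' v w = 0) :
    ∃ ε : V₀ ⊕ V₁ → ℤ, (∀ v, ε v = 1 ∨ ε v = -1) ∧
      ∀ v w, A' v w = ε v * A v w * ε w := by
  have hside : ∀ i j, A i j ≠ 0 → Sum.isLeft i ≠ Sum.isLeft j := by
    rintro (i | i) (j | j) h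
    · exact absurd (hbip₀ i j) h
    · simp
    · simp
    · exact absurd (hbip₁ i j) h
  obtain ⟨ε, hε, h⟩ := exists_signs_on (fun i j => congrFun (congrFun hskew j) i)
    (fun i j => congrFun (congrFun hskew' j) i) hent hent' hside hPU hPU' hsupp Finset.univ
  exact ⟨ε, hε, fun v w => h v (Finset.mem_univ v) w (Finset.mem_univ w)⟩
end

section
/- Let V = V₀ ⊔ V₁ be a finite set, A a principally unimodular skew-symmetric integer matrix on V with entries in {−1, 0, 1} vanishing on V₀ × V₀ and V₁ × V₁, and sgn : V → {−1, 1} a labeling. Then for every state s ⊆ V, the ℤ-module V(s) = ℤ^V / (ℤ-span of the rows of the relation matrix R(s)) is a free ℤ-module. -/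
open Matrix

/-- The relation matrix `R(s)` of a state `s`:
`R(s)_{v,w} = (1 if v = w ∧ v ∉ s) - (sgn w · A v w if w ∈ s)`. -/
def relMat {V : Type*} [DecidableEq V] (A : Matrix V V ℤ) (sgn : V → ℤ) (s : Finset V) :
    Matrix V V ℤ :=
  fun v w => (if v = w ∧ v ∉ s then 1 else 0) - (if w ∈ s then sgn w * A v w else 0)

/-- If an integer matrix has an inner inverse, the quotient by its row span is free. -/
theorem free_quotient_span_range_of_mul_mul_eq {V : Type*} [Fintype V] [DecidableEq V]
    {R G : Matrix V V ℤ} (h : R * G * R = R) :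
    Module.Free ℤ ((V → ℤ) ⧸ Submodule.span ℤ (Set.range R)) := by
  have hmem : ∀ x : V → ℤ, x ∈ Submodule.span ℤ (Set.range R) ↔ ∃ y, y ᵥ* R = x := by
    intro x
    simp only [Matrix.vecMul_eq_sum]
    exact Submodule.mem_span_range_iff_exists_fun (v := R.row) ℤ
  have : Module.IsTorsionFree ℤ ((V → ℤ) ⧸ Submodule.span ℤ (Set.range R)) := by
    refine Module.IsTorsionFree.of_smul_eq_zero fun n x hx => ?_
    obtain ⟨x, rfl⟩ := Submodule.Quotient.mk_surjective _ x
    rw [or_iff_not_imp_left]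
    intro hn
    rw [← Submodule.Quotient.mk_smul, Submodule.Quotient.mk_eq_zero, hmem] at hx
    rw [Submodule.Quotient.mk_eq_zero, hmem]
    obtain ⟨y, hy⟩ := hx
    refine ⟨x ᵥ* G, ?_⟩
    have key : n • (x ᵥ* G ᵥ* R) = n • x := by
      rw [← Matrix.smul_vecMul, ← Matrix.smul_vecMul, ← hy, Matrix.vecMul_vecMul,
        Matrix.vecMul_vecMul, ← Matrix.mul_assoc, h]
    exact smul_right_injective _ hn key
  infer_instance

/-- Principal minors can be computed along any injective indexing. -/
theorem det_submatrix_eq_det_image {V κ : Type*} [DecidableEq V] [Fintype κ] [DecidableEq κ]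
    (M : Matrix V V ℤ) {f : κ → V} (hf : Function.Injective f) :
    (M.submatrix f f).det = (M.submatrix
      (Subtype.val : {x // x ∈ Finset.univ.image f} → V) Subtype.val).det := by
  let g : κ ≃ {x // x ∈ Finset.univ.image f} :=
    Equiv.ofBijective (fun k => ⟨f k, by simp⟩) ⟨fun a b hab => hf (by simpa using hab), by
      rintro ⟨x, hx⟩
      obtain ⟨k, -, rfl⟩ := Finset.mem_image.1 hx
      exact ⟨k, rfl⟩⟩
  rw [← Matrix.det_submatrix_equiv_self g (M.submatrix Subtype.val Subtype.val)]
  rfl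

/-- A principally unimodular skew-symmetric integer matrix has an integral inner inverse. -/
theorem exists_mul_mul_eq_of_principally_unimodular {V : Type*} [Fintype V] [DecidableEq V]
    (M : Matrix V V ℤ) (hskew : Mᵀ = -M)
    (hPU : ∀ s : Finset V,
      (M.submatrix (Subtype.val : {x // x ∈ s} → V) Subtype.val).det ∈ ({0, 1} : Set ℤ)) :
    ∃ G : Matrix V V ℤ, M * G * M = M := by
  obtain ⟨t, ht, hmax⟩ := Finset.exists_max_image
    (Finset.univ.filter fun t : Finset V =>
      (M.submatrix (Subtype.val : {x // x ∈ t} → V) Subtype.val).det ≠ 0) Finset.card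
    ⟨∅, by simp⟩
  simp only [Finset.mem_filter, Finset.mem_univ, true_and] at ht hmax
  have hsk : ∀ i j, M j i = -M i j := fun i j => congrFun (congrFun hskew i) j
  let e : {x // x ∈ t} ⊕ {x // x ∉ t} ≃ V := Equiv.sumCompl (· ∈ t)
  set P : Matrix {x // x ∈ t} {x // x ∈ t} ℤ := M.submatrix Subtype.val Subtype.val
  set Q : Matrix {x // x ∈ t} {x // x ∉ t} ℤ := M.submatrix Subtype.val Subtype.val
  set R : Matrix {x // x ∉ t} {x // x ∈ t} ℤ := M.submatrix Subtype.val Subtype.val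
  set S : Matrix {x // x ∉ t} {x // x ∉ t} ℤ := M.submatrix Subtype.val Subtype.val
  have hdet : P.det = 1 := (hPU t).resolve_left ht
  have hu : IsUnit P.det := by rw [hdet]; exact isUnit_one
  have hblocks : M = (fromBlocks P Q R S).submatrix e.symm e.symm := by
    have : M.submatrix e e = fromBlocks P Q R S := by
      ext (i | i) (j | j) <;> rfl
    rw [← this]
    ext i j
    simp
  have hPt : Pᵀ = -P := by ext i j; exact hsk _ _
  have hQt : Qᵀ = -R := by ext i j; exact hsk _ _
  have hRt : Rᵀ = -Q := by ext i j; exact hsk _ _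
  have hSt : Sᵀ = -S := by ext i j; exact hsk _ _
  have hPit : P⁻¹ᵀ = -P⁻¹ := by
    rw [Matrix.transpose_nonsing_inv, hPt]
    refine Matrix.inv_eq_left_inv ?_
    rw [neg_mul_neg, Matrix.nonsing_inv_mul _ hu]
  set T := S - R * P⁻¹ * Q with hT
  have hTt : Tᵀ = -T := by
    rw [hT, Matrix.transpose_sub, Matrix.transpose_mul, Matrix.transpose_mul, hPit, hQt, hRt, hSt]
    simp only [Matrix.neg_mul, Matrix.mul_neg, neg_neg, Matrix.mul_assoc]
    abel
  have hTsk : ∀ i j, T j i = -T i j := fun i j => congrFun (congrFun hTt i) j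
  have hT0 : T = 0 := by
    ext i j
    by_cases hij : i = j
    · subst hij
      have := hTsk i i
      simp only [Matrix.zero_apply]
      omega
    · let c : Fin 2 → {x // x ∉ t} := ![i, j]
      let f : {x // x ∈ t} ⊕ Fin 2 → V := Sum.elim Subtype.val fun k => (c k : V)
      have hc : Function.Injective c := by
        intro a b hab
        have hji : ¬ j = i := fun h => hij h.symm
        fin_cases a <;> fin_cases b <;> simp [c, hij, hji] at hab ⊢
      have hf : Function.Injective f :=
        Subtype.val_injective.sumElim (Subtype.val_injective.comp hc)
          fun a b hab => (c b).2 (hab ▸ a.2)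
      have hzero : (M.submatrix f f).det = 0 := by
        by_contra hne
        rw [det_submatrix_eq_det_image M hf] at hne
        have := hmax _ hne
        rw [Finset.card_image_of_injective _ hf] at this
        simp at this
      have hf' : M.submatrix f f = fromBlocks P (Q.submatrix id c) (R.submatrix c id)
          (S.submatrix c c) := by
        ext (a | a) (b | b) <;> rfl
      let := Matrix.invertibleOfIsUnitDet P hu
      rw [hf', Matrix.det_fromBlocks₁₁, hdet, one_mul, Matrix.invOf_eq_nonsing_inv] at hzero
      have hsub : S.submatrix c c - R.submatrix c id * P⁻¹ * Q.submatrix id c =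
          T.submatrix c c := by
        ext a b
        simp [hT, Matrix.mul_apply]
      rw [hsub, Matrix.det_fin_two] at hzero
      have h1 := hTsk i i
      have h2 := hTsk i j
      have h3 : T i i = 0 := by omega
      simp only [Matrix.submatrix_apply, c, Matrix.cons_val_zero, Matrix.cons_val_one, h2, h3]
        at hzero
      simp only [Matrix.zero_apply]
      nlinarith
  refine ⟨(fromBlocks P⁻¹ 0 0 0).submatrix e.symm e.symm, ?_⟩
  have hS' : R * P⁻¹ * Q = S := (sub_eq_zero.1 hT0).symm
  rw [hblocks, Matrix.submatrix_mul_equiv, Matrix.submatrix_mul_equiv, Matrix.fromBlocks_multiply,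
    Matrix.fromBlocks_multiply]
  simp [Matrix.mul_nonsing_inv _ hu, Matrix.nonsing_inv_mul_cancel_right _ _ hu, hS']

/-- The diagonal idempotent of a state. -/
def stateIdempotent {V : Type*} [DecidableEq V] (s : Finset V) : Matrix V V ℤ :=
  Matrix.diagonal fun v => if v ∈ s then 1 else 0

theorem stateIdempotent_mul_self {V : Type*} [Fintype V] [DecidableEq V] (s : Finset V) :
    stateIdempotent s * stateIdempotent s = stateIdempotent s := by
  simp [stateIdempotent]

theorem stateIdempotent_mul_mul_apply {V : Type*} [Fintype V] [DecidableEq V] (s : Finset V)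
    (A : Matrix V V ℤ) (i j : V) :
    (stateIdempotent s * A * stateIdempotent s) i j = if i ∈ s ∧ j ∈ s then A i j else 0 := by
  by_cases hi : i ∈ s <;> by_cases hj : j ∈ s <;> simp [stateIdempotent, hi, hj]

theorem relMat_eq {V : Type*} [Fintype V] [DecidableEq V] (A : Matrix V V ℤ) (sgn : V → ℤ)
    (s : Finset V) :
    relMat A sgn s =
      (1 - stateIdempotent s) - A * Matrix.diagonal sgn * stateIdempotent s := by
  ext v w
  by_cases hw : w ∈ s <;> by_cases hvw : v = w <;>
    simp_all [relMat, stateIdempotent, mul_comm]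

/-- An inner inverse of the corner `E A E` yields one of `(1 - E) - A D E`. -/
theorem exists_inner_inverse_of_corner {α : Type*} [Ring α] {E D A G : α} (hE : E * E = E)
    (hD : D * D = 1) (hDE : D * E = E * D) (h : E * A * E * G * (E * A * E) = E * A * E) :
    ∃ H, ((1 - E) - A * D * E) * H * ((1 - E) - A * D * E) = (1 - E) - A * D * E := by
  have hEF : E * (1 - E) = 0 := by rw [mul_sub, mul_one, hE, sub_self]
  have hFE : (1 - E) * E = 0 := by rw [sub_mul, one_mul, hE, sub_self]
  have hFF : (1 - E) * (1 - E) = 1 - E := by rw [mul_sub, hFE, mul_one, sub_zero]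
  set F := 1 - E with hF
  set N := F - E * A * E * D with hN
  have hEDF : E * D * F = 0 := by rw [← hDE, mul_assoc, hEF, mul_zero]
  have hNF : N * F = F := by
    rw [hN, sub_mul, hFF, mul_assoc (E * A), mul_assoc (E * A), hEDF, mul_zero, sub_zero]
  have hR : F - A * D * E = N * (1 - F * A * E * D) := by
    have h1 : A * D * E = (E + F) * A * E * D := by
      rw [hF, add_sub_cancel, one_mul, mul_assoc, hDE, mul_assoc]
    rw [mul_sub, mul_one, ← mul_assoc, ← mul_assoc, ← mul_assoc, hNF, h1, hN]
    noncomm_ring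
  have hW : (1 - F * A * E * D) * (1 + F * A * E * D) = 1 := by
    calc _ = 1 - F * A * (E * D * F) * A * E * D := by noncomm_ring
      _ = 1 := by rw [hEDF]; simp
  have hNN : N * (F - D * (E * G * E)) * N = N := by
    have hFN : F * N = F := by
      rw [hN, mul_sub, hFF, ← mul_assoc, ← mul_assoc, ← mul_assoc, hFE]
      simp
    have hNG : N * (D * (E * G * E)) = - (E * A * E * G * E) := by
      calc _ = F * D * E * G * E - E * A * E * (D * D) * E * G * E := by rw [hN]; noncomm_ring
        _ = F * E * D * G * E - E * A * (E * E) * G * E := by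
          rw [hD, mul_assoc F D E, hDE]; noncomm_ring
        _ = _ := by rw [hFE, hE]; simp
    calc _ = (N * F) * N - N * (D * (E * G * E)) * N := by noncomm_ring
      _ = F + E * A * E * G * (E * N) := by rw [hNF, hFN, hNG]; noncomm_ring
      _ = F - E * A * E * G * (E * A * E) * D := by
        have : E * N = - (E * A * E * D) := by
          rw [hN, mul_sub, hEF, ← mul_assoc, ← mul_assoc, ← mul_assoc, hE, zero_sub]
        rw [this]; noncomm_ring
      _ = N := by rw [h]
  refine ⟨(1 + F * A * E * D) * (F - D * (E * G * E)), ?_⟩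
  rw [hR]
  calc _ = N * ((1 - F * A * E * D) * (1 + F * A * E * D)) * (F - D * (E * G * E)) * N *
        (1 - F * A * E * D) := by simp only [mul_assoc]
    _ = _ := by rw [hW, mul_one, hNN]

/-- Restricting to a state preserves principal unimodularity. -/
theorem principally_unimodular_corner {V : Type*} [Fintype V] [DecidableEq V]
    (A : Matrix V V ℤ)
    (hPU : ∀ s : Finset V,
      (A.submatrix (Subtype.val : {x // x ∈ s} → V) Subtype.val).det ∈ ({0, 1} : Set ℤ))
    (s t : Finset V) :
    ((stateIdempotent s * A * stateIdempotent s).submatrix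
      (Subtype.val : {x // x ∈ t} → V) Subtype.val).det ∈ ({0, 1} : Set ℤ) := by
  by_cases hts : t ⊆ s
  · suffices h : (stateIdempotent s * A * stateIdempotent s).submatrix
        (Subtype.val : {x // x ∈ t} → V) Subtype.val = A.submatrix Subtype.val Subtype.val by
      rw [h]
      exact hPU t
    ext i j
    exact (stateIdempotent_mul_mul_apply s A i j).trans (if_pos ⟨hts i.2, hts j.2⟩)
  · obtain ⟨x, hxt, hxs⟩ := Finset.not_subset.1 hts
    left
    refine Matrix.det_eq_zero_of_row_eq_zero ⟨x, hxt⟩ fun j => ?_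
    rw [Matrix.submatrix_apply, stateIdempotent_mul_mul_apply, if_neg fun h => hxs h.1]

/-- for a principally unimodular bipartite skew-symmetric `±1/0` matrix
and any labeling `sgn`, the module `V(s) = ℤ^V / rowspan R(s)` is free for every
state `s`. -/
theorem stmt11 {V₀ V₁ : Type*} [Fintype V₀] [Fintype V₁] [DecidableEq V₀] [DecidableEq V₁]
    (A : Matrix (V₀ ⊕ V₁) (V₀ ⊕ V₁) ℤ) (hskew : Aᵀ = -A)
    (hent : ∀ i j, A i j ∈ ({-1, 0, 1} : Set ℤ))
    (hbip₀ : ∀ i j : V₀, A (Sum.inl i) (Sum.inl j) = 0)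
    (hbip₁ : ∀ i j : V₁, A (Sum.inr i) (Sum.inr j) = 0)
    (hPU : ∀ s : Finset (V₀ ⊕ V₁),
      (A.submatrix (Subtype.val : {x // x ∈ s} → (V₀ ⊕ V₁)) Subtype.val).det
        ∈ ({0, 1} : Set ℤ))
    (sgn : V₀ ⊕ V₁ → ℤ) (hsgn : ∀ v, sgn v = 1 ∨ sgn v = -1)
    (s : Finset (V₀ ⊕ V₁)) :
    Module.Free ℤ
      (((V₀ ⊕ V₁) → ℤ) ⧸ Submodule.span ℤ (Set.range (relMat A sgn s))) := by
  set E := stateIdempotent s with hE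
  obtain ⟨G, hG⟩ := exists_mul_mul_eq_of_principally_unimodular (E * A * E)
    (by
      rw [Matrix.transpose_mul, Matrix.transpose_mul, hskew, hE, stateIdempotent,
        Matrix.diagonal_transpose]
      simp [Matrix.mul_assoc])
    (principally_unimodular_corner A hPU s)
  obtain ⟨H, hH⟩ := exists_inner_inverse_of_corner (D := Matrix.diagonal sgn)
    (stateIdempotent_mul_self s)
    (by
      rw [Matrix.diagonal_mul_diagonal, ← Matrix.diagonal_one]
      congr 1
      funext v
      rcases hsgn v with h | h <;> simp [h])
    (by simp [stateIdempotent, Matrix.diagonal_mul_diagonal, mul_comm]) hG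
  rw [← relMat_eq] at hH
  exact free_quotient_span_range_of_mul_mul_eq hH
end

section
/- Let V = V₀ ⊔ V₁ be a finite set, A a principally unimodular skew-symmetric integer matrix on V with entries in {−1, 0, 1} vanishing on V₀ × V₀ and V₁ × V₁, and sgn : V → {−1, 1} a labeling. Then for every state s ⊆ V and every i ∈ V with (i ∉ s if sgn(i) = −1, and i ∈ s if sgn(i) = 1), the following are equivalent: the standard basis vector e_i lies in the ℤ-span of the rows of R(s) (i.e., x_i = 0 in V(s)), and corank A(s ⊕ i) = corank A(s) + 1. -/
open Matrix

/-- The corank of the principal submatrix `A(s)`: `|s|` minus its rank over `ℚ`. -/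
noncomputable def pcorank {V : Type*} [DecidableEq V] (A : Matrix V V ℤ) (s : Finset V) : ℤ :=
  (s.card : ℤ) -
    (Matrix.rank (Matrix.map
      (A.submatrix (Subtype.val : {x // x ∈ s} → V) (Subtype.val : {x // x ∈ s} → V))
      (Int.cast : ℤ → ℚ)) : ℤ)

/-- `s ⊕ i`: toggle membership of `i` in `s`. -/
def stoggle {V : Type*} [DecidableEq V] (s : Finset V) (i : V) : Finset V :=
  if i ∈ s then s.erase i else insert i s

/-- The kernel of the principal submatrix `A(s)`, extended by zero to a subspace of `V → ℚ`. -/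
def principalKer {V : Type*} [Fintype V] (A : Matrix V V ℤ) (s : Finset V) :
    Submodule ℚ (V → ℚ) where
  carrier := {x | (∀ v, v ∉ s → x v = 0) ∧ ∀ w ∈ s, ∑ v, (A w v : ℚ) * x v = 0}
  zero_mem' := by simp
  add_mem' := by
    rintro x y ⟨hx, hx'⟩ ⟨hy, hy'⟩
    refine ⟨fun v hv => by simp [hx v hv, hy v hv], fun w hw => ?_⟩
    simp [mul_add, Finset.sum_add_distrib, hx' w hw, hy' w hw]
  smul_mem' := by
    rintro c x ⟨hx, hx'⟩
    refine ⟨fun v hv => by simp [hx v hv], fun w hw => ?_⟩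
    simp [mul_left_comm _ c, ← Finset.mul_sum, hx' w hw]

theorem mem_principalKer {V : Type*} [Fintype V] {A : Matrix V V ℤ} {s : Finset V} {x : V → ℚ} :
    x ∈ principalKer A s ↔
      (∀ v, v ∉ s → x v = 0) ∧ ∀ w ∈ s, ∑ v, (A w v : ℚ) * x v = 0 :=
  Iff.rfl

theorem sum_univ_eq_sum_subtype {V M : Type*} [Fintype V] [AddCommMonoid M] {s : Finset V}
    {f : V → M} (hf : ∀ v, v ∉ s → f v = 0) : ∑ v, f v = ∑ v : {v // v ∈ s}, f v := by
  rw [Finset.sum_coe_sort s f]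
  exact (Finset.sum_subset (Finset.subset_univ s) fun v _ hv => hf v hv).symm

theorem pcorank_eq_finrank_principalKer {V : Type*} [Fintype V] [DecidableEq V]
    (A : Matrix V V ℤ) (s : Finset V) :
    pcorank A s = Module.finrank ℚ (principalKer A s) := by
  set M := Matrix.map
    (A.submatrix (Subtype.val : {x // x ∈ s} → V) (Subtype.val : {x // x ∈ s} → V))
    (Int.cast : ℤ → ℚ) with hM
  have hrank := LinearMap.finrank_range_add_finrank_ker M.mulVecLin
  have hker : ∀ x : {x // x ∈ s} → ℚ, x ∈ LinearMap.ker M.mulVecLin ↔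
      ∀ w : {x // x ∈ s}, ∑ v : {x // x ∈ s}, (A w v : ℚ) * x v = 0 := by
    intro x
    rw [LinearMap.mem_ker, funext_iff]
    rfl
  let e : principalKer A s ≃ₗ[ℚ] LinearMap.ker M.mulVecLin :=
    { toFun := fun x => ⟨fun v => x.1 v, by
        rw [hker]
        intro w
        rw [← x.2.2 w w.2, sum_univ_eq_sum_subtype (s := s)]
        intro v hv
        rw [x.2.1 v hv, mul_zero]⟩
      map_add' := fun _ _ => rfl
      map_smul' := fun _ _ => rfl
      invFun := fun x => ⟨fun v => if h : v ∈ s then x.1 ⟨v, h⟩ else 0, by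
        refine ⟨fun v hv => by simp [hv], fun w hw => ?_⟩
        rw [sum_univ_eq_sum_subtype (s := s) fun v hv => by simp [hv]]
        simpa using (hker x.1).1 x.2 ⟨w, hw⟩⟩
      left_inv := by
        intro x
        ext v
        by_cases hv : v ∈ s
        · simp [hv]
        · simp [hv, x.2.1 v hv]
      right_inv := by
        intro x
        ext v
        simp }
  rw [e.finrank_eq, pcorank, ← hM, Matrix.rank]
  simp only [Module.finrank_fintype_fun_eq_card, Fintype.card_coe] at hrank
  omega

theorem finrank_inf_ker_of_forall_eq_zero {E : Type*} [AddCommGroup E] [Module ℚ E]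
    (K : Submodule ℚ E) (f : Module.Dual ℚ E) (h : ∀ x ∈ K, f x = 0) :
    Module.finrank ℚ (K ⊓ LinearMap.ker f : Submodule ℚ E) = Module.finrank ℚ K := by
  rw [inf_eq_left.2 fun x hx => LinearMap.mem_ker.2 (h x hx)]

theorem finrank_inf_ker_add_one {E : Type*} [AddCommGroup E] [Module ℚ E]
    [FiniteDimensional ℚ E] (K : Submodule ℚ E) (f : Module.Dual ℚ E)
    (h : ¬ ∀ x ∈ K, f x = 0) :
    Module.finrank ℚ (K ⊓ LinearMap.ker f : Submodule ℚ E) + 1 = Module.finrank ℚ K := by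
  have hf : f.domRestrict K ≠ 0 := fun h0 =>
    h fun x hx => by simpa using LinearMap.congr_fun h0 ⟨x, hx⟩
  rw [← Module.Dual.finrank_ker_add_one_of_ne_zero (f := f.domRestrict K) hf,
    LinearMap.ker_domRestrict, ← Submodule.map_comap_subtype,
    LinearEquiv.finrank_eq (Submodule.equivMapOfInjective K.subtype K.injective_subtype _).symm]

/-- Row vectors that kill the rational kernel of a matrix lie in the rational row space. -/
theorem mem_span_rows_of_forall_mulVec_eq_zero {S : Type*} [Fintype S]
    (M : Matrix S S ℚ) (b : S → ℚ) (h : ∀ x, M *ᵥ x = 0 → b ⬝ᵥ x = 0) :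
    b ∈ Submodule.span ℚ (Set.range M) := by
  classical
  by_contra hb
  obtain ⟨f, hfb, hf⟩ := Submodule.exists_le_ker_of_notMem hb
  have hfx : ∀ x, f x = x ⬝ᵥ fun i => f (Pi.single i 1) := by
    intro x
    conv_lhs => rw [← Finset.univ_sum_single x]
    rw [map_sum, dotProduct]
    refine Finset.sum_congr rfl fun i _ => ?_
    rw [← mul_one (x i), ← smul_eq_mul, Pi.single_smul, map_smul]
    simp
  refine hfb ?_
  rw [hfx]
  refine h _ (funext fun v => ?_)
  have := hf (Submodule.subset_span ⟨v, rfl⟩)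
  rw [LinearMap.mem_ker, hfx] at this
  exact this

/-- Restricting a skew-symmetric matrix to a row basis gives a nonsingular principal submatrix. -/
theorem det_submatrix_ne_zero_of_skew {S κ : Type*} [Fintype S] [Fintype κ] [DecidableEq κ]
    (M : Matrix S S ℚ) (hskew : Mᵀ = -M) (a : κ → S)
    (hspan : Submodule.span ℚ (Set.range (M ∘ a)) = Submodule.span ℚ (Set.range M))
    (hli : LinearIndependent ℚ (M ∘ a)) : (M.submatrix a a).det ≠ 0 := by
  intro hdet
  obtain ⟨x, hx0, hx⟩ := Matrix.exists_vecMul_eq_zero_iff.2 hdet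
  refine hx0 ?_
  have hsk : ∀ v w, M v w = - M w v := fun v w => congrFun (congrFun hskew w) v
  let g : (S → ℚ) →ₗ[ℚ] ℚ := ∑ k, x k • LinearMap.proj (a k)
  have hg : ∀ u, g u = ∑ k, x k * u (a k) := by
    intro u
    simp [g, LinearMap.sum_apply]
  have hle : Submodule.span ℚ (Set.range (M ∘ a)) ≤ LinearMap.ker g := by
    rw [Submodule.span_le]
    rintro _ ⟨k, rfl⟩
    rw [SetLike.mem_coe, LinearMap.mem_ker, hg]
    have := congrFun hx k
    simp only [Matrix.vecMul, dotProduct, Matrix.submatrix_apply, Pi.zero_apply] at this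
    rw [← neg_eq_zero, ← this, ← Finset.sum_neg_distrib]
    refine Finset.sum_congr rfl fun l _ => ?_
    rw [hsk (a l) (a k), mul_neg]
    rfl
  rw [hspan] at hle
  funext k
  refine Fintype.linearIndependent_iff.1 hli x ?_ k
  funext w
  have hw := hle (Submodule.subset_span ⟨w, rfl⟩)
  rw [LinearMap.mem_ker, hg] at hw
  rw [Finset.sum_apply, Pi.zero_apply, ← neg_eq_zero, ← hw, ← Finset.sum_neg_distrib]
  refine Finset.sum_congr rfl fun l _ => ?_
  rw [hsk w (a l), mul_neg]
  rfl

/-- For a principally unimodular skew-symmetric matrix, integer vectors that kill the rational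
kernel lie in the integer row space. -/
theorem mem_span_int_rows_of_forall_mulVec_eq_zero {S : Type*} [Fintype S] [DecidableEq S]
    (M : Matrix S S ℤ) (hskew : Mᵀ = -M)
    (hPU : ∀ s : Finset S,
      (M.submatrix (Subtype.val : {x // x ∈ s} → S) Subtype.val).det ∈ ({0, 1} : Set ℤ))
    (b : S → ℤ)
    (h : ∀ x : S → ℚ, M.map (Int.cast : ℤ → ℚ) *ᵥ x = 0 → ∑ v, (b v : ℚ) * x v = 0) :
    b ∈ Submodule.span ℤ (Set.range M) := by
  classical
  set Q : Matrix S S ℚ := M.map (Int.cast : ℤ → ℚ) with hQ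
  have hQskew : Qᵀ = -Q := by
    ext v w
    have := congrFun (congrFun hskew v) w
    simp only [Matrix.transpose_apply, Matrix.neg_apply] at this
    simp [hQ, this]
  have hb := mem_span_rows_of_forall_mulVec_eq_zero Q (fun v => (b v : ℚ)) h
  obtain ⟨κ, a, ha, hspan, hli⟩ := exists_linearIndependent' ℚ Q
  have : Fintype κ := Fintype.ofInjective a ha
  have hdet := det_submatrix_ne_zero_of_skew Q hQskew a hspan hli
  rw [← hspan, Submodule.mem_span_range_iff_exists_fun] at hb
  obtain ⟨c, hc⟩ := hb
  have hcast : Q.submatrix a a = (M.submatrix a a).map (Int.castRingHom ℚ) := by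
    ext
    simp [hQ]
  have hunit : IsUnit (M.submatrix a a).det := by
    let e : κ ≃ {x // x ∈ Finset.univ.image a} :=
      Equiv.ofBijective (fun k => ⟨a k, by simp⟩)
        ⟨fun k l hkl => ha (Subtype.ext_iff.1 hkl), fun ⟨x, hx⟩ => by
          obtain ⟨k, -, hk⟩ := Finset.mem_image.1 hx
          exact ⟨k, Subtype.ext hk⟩⟩
    have he := Matrix.det_submatrix_equiv_self e
      (M.submatrix (Subtype.val : {x // x ∈ Finset.univ.image a} → S) Subtype.val)
    rw [Matrix.submatrix_submatrix] at he
    change (M.submatrix a a).det = _ at he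
    rcases hPU (Finset.univ.image a) with h0 | h1
    · refine absurd ?_ hdet
      rw [hcast, ← RingHom.mapMatrix_apply, ← RingHom.map_det, he, h0, map_zero]
    · rw [he, h1]
      exact isUnit_one
  let y : κ → ℤ := (b ∘ a) ᵥ* (M.submatrix a a)⁻¹
  have hy : y ᵥ* M.submatrix a a = b ∘ a := by
    rw [Matrix.vecMul_vecMul, Matrix.nonsing_inv_mul _ hunit, Matrix.vecMul_one]
  have hyc : (fun k => (y k : ℚ)) = c := by
    refine Matrix.vecMul_injective_of_isUnit
      ((Matrix.isUnit_iff_isUnit_det _).2 (isUnit_iff_ne_zero.2 hdet)) ?_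
    funext k
    have h1 := congrArg (Int.cast : ℤ → ℚ) (congrFun hy k)
    have h2 := congrFun hc (a k)
    simp only [Matrix.vecMul, dotProduct, Matrix.submatrix_apply, Int.cast_sum, Int.cast_mul,
      Function.comp_apply] at h1
    rw [Finset.sum_apply] at h2
    exact h1.trans h2.symm
  have hby : b = ∑ k, y k • M (a k) := by
    funext w
    have h2 := congrFun hc w
    rw [← hyc] at h2
    rw [Finset.sum_apply] at h2 ⊢
    change ∑ k, (y k : ℚ) * (M (a k) w : ℚ) = (b w : ℚ) at h2
    exact_mod_cast h2.symm
  rw [hby]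
  exact Submodule.sum_mem _ fun k _ => Submodule.smul_mem _ _ (Submodule.subset_span ⟨a k, rfl⟩)

theorem sum_vecMul_mul_eq_sum_mul_mulVec {V : Type*} [Fintype V] (A : Matrix V V ℤ) (y : V → ℤ) (x : V → ℚ) :
    ∑ w, ((∑ v, y v * A v w : ℤ) : ℚ) * x w = ∑ v, (y v : ℚ) * ∑ w, (A v w : ℚ) * x w := by
  simp only [Int.cast_sum, Int.cast_mul, Finset.sum_mul, Finset.mul_sum]
  rw [Finset.sum_comm]
  simp only [mul_assoc]

/-- The functional `x ↦ ∑ v, A j v * x v`. -/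
def rowFunctional {V : Type*} [Fintype V] (A : Matrix V V ℤ) (j : V) : Module.Dual ℚ (V → ℚ) :=
  ∑ v, (A j v : ℚ) • LinearMap.proj v

theorem rowFunctional_apply {V : Type*} [Fintype V] (A : Matrix V V ℤ) (j : V) (x : V → ℚ) :
    rowFunctional A j x = ∑ v, (A j v : ℚ) * x v := by
  simp [rowFunctional, LinearMap.sum_apply]

section PrincipallyUnimodular

variable {V : Type*} [Fintype V] [DecidableEq V] {A : Matrix V V ℤ}

theorem exists_int_combination_of_forall_principalKer (hskew : Aᵀ = -A)
    (hPU : ∀ s : Finset V,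
      (A.submatrix (Subtype.val : {x // x ∈ s} → V) Subtype.val).det ∈ ({0, 1} : Set ℤ))
    (s : Finset V) (b : V → ℤ)
    (h : ∀ x ∈ principalKer A s, ∑ v, (b v : ℚ) * x v = 0) :
    ∃ y : V → ℤ, (∀ v, v ∉ s → y v = 0) ∧ ∀ w ∈ s, ∑ v, y v * A v w = b w := by
  let M : Matrix {x // x ∈ s} {x // x ∈ s} ℤ := A.submatrix Subtype.val Subtype.val
  have hM : (fun v : {x // x ∈ s} => b v) ∈ Submodule.span ℤ (Set.range M) := by
    refine mem_span_int_rows_of_forall_mulVec_eq_zero M ?_ ?_ _ ?_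
    · exact congrArg (fun B : Matrix V V ℤ => B.submatrix Subtype.val Subtype.val) hskew
    · intro t
      let e : {x // x ∈ t} ≃ {x // x ∈ t.image Subtype.val} :=
        Equiv.ofBijective (fun k => ⟨k.1.1, Finset.mem_image_of_mem _ k.2⟩)
          ⟨fun k l hkl => Subtype.ext (Subtype.ext (Subtype.mk.inj hkl)), fun ⟨x, hx⟩ => by
            obtain ⟨k, hk, hkx⟩ := Finset.mem_image.1 hx
            exact ⟨⟨k, hk⟩, Subtype.ext hkx⟩⟩
      have he := Matrix.det_submatrix_equiv_self e
        (A.submatrix (Subtype.val : {x // x ∈ t.image Subtype.val} → V) Subtype.val)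
      have := hPU (t.image Subtype.val)
      rw [← he] at this
      exact this
    · intro x hx
      have hmem : (fun v => if hv : v ∈ s then x ⟨v, hv⟩ else 0) ∈ principalKer A s := by
        refine ⟨fun v hv => by simp [hv], fun w hw => ?_⟩
        rw [sum_univ_eq_sum_subtype (s := s) (fun v hv => by simp [hv])]
        simpa [M, Matrix.mulVec, dotProduct] using congrFun hx ⟨w, hw⟩
      have := h _ hmem
      rw [sum_univ_eq_sum_subtype (s := s) (fun v hv => by simp [hv])] at this
      simpa using this
  obtain ⟨c, hc⟩ := (Submodule.mem_span_range_iff_exists_fun ℤ).1 hM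
  refine ⟨fun v => if hv : v ∈ s then c ⟨v, hv⟩ else 0, fun v hv => by simp [hv],
    fun w hw => ?_⟩
  rw [sum_univ_eq_sum_subtype (s := s) (fun v hv => by simp [hv])]
  simpa [M] using congrFun hc ⟨w, hw⟩

/-- Adding `j` to a state cannot both keep the rank and kill the coordinate `x_j` on the kernel. -/
theorem exists_mem_principalKer_insert_ne_zero (hskew : Aᵀ = -A)
    (hPU : ∀ s : Finset V,
      (A.submatrix (Subtype.val : {x // x ∈ s} → V) Subtype.val).det ∈ ({0, 1} : Set ℤ))
    {t : Finset V} {j : V} (hj : j ∉ t)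
    (h : ∀ x ∈ principalKer A t, ∑ v, (A j v : ℚ) * x v = 0) :
    ∃ x ∈ principalKer A (insert j t), x j ≠ 0 := by
  have hsk : ∀ v w, A v w = - A w v := fun v w => congrFun (congrFun hskew w) v
  obtain ⟨z, hz, hzA⟩ := exists_int_combination_of_forall_principalKer hskew hPU t (A j) h
  have hAz : ∀ w, ∑ v, A w v * z v = - ∑ v, z v * A v w := by
    intro w
    rw [← Finset.sum_neg_distrib]
    exact Finset.sum_congr rfl fun v _ => by rw [hsk w v]; ring
  have key : ∀ w ∈ insert j t, ∑ v, A w v * (Pi.single j 1 - z : V → ℤ) v = 0 := by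
    intro w hw
    simp only [Pi.sub_apply, mul_sub, Finset.sum_sub_distrib, hAz]
    simp only [Pi.single_apply, mul_ite, mul_one, mul_zero, Finset.sum_ite_eq', Finset.mem_univ,
      if_true]
    rcases Finset.mem_insert.1 hw with rfl | hw
    · have hww : A w w = 0 := by
        have := hsk w w
        omega
      have h0 : ∑ v, z v * ∑ u, z u * A u v = ∑ v, z v * A w v := by
        refine Finset.sum_congr rfl fun v _ => ?_
        by_cases hv : v ∈ t
        · rw [hzA v hv]
        · rw [hz v hv, zero_mul, zero_mul]
      have h1 : ∑ v, z v * ∑ u, z u * A u v = - ∑ v, z v * ∑ u, z u * A u v := by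
        conv_lhs => simp only [Finset.mul_sum]
        rw [Finset.sum_comm, ← Finset.sum_neg_distrib]
        refine Finset.sum_congr rfl fun v _ => ?_
        rw [Finset.mul_sum, ← Finset.sum_neg_distrib]
        exact Finset.sum_congr rfl fun u _ => by rw [hsk v u]; ring
      have h2 : ∑ v, z v * A v w = - ∑ v, z v * A w v := by
        rw [← Finset.sum_neg_distrib]
        exact Finset.sum_congr rfl fun v _ => by rw [hsk v w]; ring
      omega
    · rw [hzA w hw, hsk w j]
      ring
  refine ⟨fun v => ((Pi.single j 1 - z : V → ℤ) v : ℚ), ⟨fun v hv => ?_, fun w hw => ?_⟩, ?_⟩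
  · rw [Finset.mem_insert, not_or] at hv
    simp [hz v hv.2, hv.1]
  · have := key w hw
    beta_reduce
    exact_mod_cast this
  · simp [hz j hj]

theorem principalKer_inf_ker_rowFunctional {t : Finset V} {j : V} (hj : j ∉ t) :
    principalKer A t ⊓ LinearMap.ker (rowFunctional A j) =
      principalKer A (insert j t) ⊓ LinearMap.ker (LinearMap.proj j : Module.Dual ℚ (V → ℚ)) := by
  ext x
  simp only [Submodule.mem_inf, mem_principalKer, LinearMap.mem_ker, rowFunctional_apply,
    LinearMap.proj_apply, Finset.mem_insert, forall_eq_or_imp, not_or]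
  constructor
  · rintro ⟨⟨h1, h2⟩, h3⟩
    exact ⟨⟨fun v hv => h1 v hv.2, h3, h2⟩, h1 j hj⟩
  · rintro ⟨⟨h1, h3, h2⟩, h4⟩
    refine ⟨⟨fun v hv => ?_, h2⟩, h3⟩
    by_cases hvj : v = j
    · rw [hvj, h4]
    · exact h1 v ⟨hvj, hv⟩

theorem pcorank_insert_eq_add_one_iff (hskew : Aᵀ = -A)
    (hPU : ∀ s : Finset V,
      (A.submatrix (Subtype.val : {x // x ∈ s} → V) Subtype.val).det ∈ ({0, 1} : Set ℤ))
    {t : Finset V} {j : V} (hj : j ∉ t) :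
    pcorank A (insert j t) = pcorank A t + 1 ↔
      ∀ x ∈ principalKer A t, ∑ v, (A j v : ℚ) * x v = 0 := by
  simp only [pcorank_eq_finrank_principalKer, ← rowFunctional_apply]
  have hinf := principalKer_inf_ker_rowFunctional (A := A) hj
  constructor
  · intro h
    by_contra hrow
    have h1 := finrank_inf_ker_add_one _ _ hrow
    rw [hinf] at h1
    by_cases hcol : ∀ x ∈ principalKer A (insert j t),
        (LinearMap.proj j : Module.Dual ℚ (V → ℚ)) x = 0
    · have h2 := finrank_inf_ker_of_forall_eq_zero _ _ hcol
      omega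
    · have h2 := finrank_inf_ker_add_one _ _ hcol
      omega
  · intro hrow
    have h1 := finrank_inf_ker_of_forall_eq_zero _ _ hrow
    rw [hinf] at h1
    have hcol : ¬ ∀ x ∈ principalKer A (insert j t),
        (LinearMap.proj j : Module.Dual ℚ (V → ℚ)) x = 0 := by
      intro hcol
      simp only [rowFunctional_apply] at hrow
      obtain ⟨x, hx, hxj⟩ := exists_mem_principalKer_insert_ne_zero hskew hPU hj hrow
      exact hxj (hcol x hx)
    have h2 := finrank_inf_ker_add_one _ _ hcol
    omega

theorem pcorank_eq_insert_add_one_iff (hskew : Aᵀ = -A)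
    (hPU : ∀ s : Finset V,
      (A.submatrix (Subtype.val : {x // x ∈ s} → V) Subtype.val).det ∈ ({0, 1} : Set ℤ))
    {t : Finset V} {j : V} (hj : j ∉ t) :
    pcorank A t = pcorank A (insert j t) + 1 ↔
      ∀ x ∈ principalKer A (insert j t), x j = 0 := by
  simp only [pcorank_eq_finrank_principalKer]
  have hinf := principalKer_inf_ker_rowFunctional (A := A) hj
  constructor
  · intro h
    by_contra hcol
    have h1 := finrank_inf_ker_add_one _ (LinearMap.proj j : Module.Dual ℚ (V → ℚ)) hcol
    rw [← hinf] at h1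
    by_cases hrow : ∀ x ∈ principalKer A t, rowFunctional A j x = 0
    · have h2 := finrank_inf_ker_of_forall_eq_zero _ _ hrow
      omega
    · have h2 := finrank_inf_ker_add_one _ _ hrow
      omega
  · intro hcol
    have h1 := finrank_inf_ker_of_forall_eq_zero _
      (LinearMap.proj j : Module.Dual ℚ (V → ℚ)) hcol
    rw [← hinf] at h1
    have hrow : ¬ ∀ x ∈ principalKer A t, rowFunctional A j x = 0 := by
      intro hrow
      simp only [rowFunctional_apply] at hrow
      obtain ⟨x, hx, hxj⟩ := exists_mem_principalKer_insert_ne_zero hskew hPU hj hrow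
      exact hxj (hcol x hx)
    have h2 := finrank_inf_ker_add_one _ _ hrow
    omega

theorem single_mem_span_relMat_iff (sgn : V → ℤ) (s : Finset V) (i : V) :
    Pi.single i (1 : ℤ) ∈ Submodule.span ℤ (Set.range (relMat A sgn s)) ↔
      ∃ y : V → ℤ, (∀ w, w ∉ s → y w = if w = i then 1 else 0) ∧
        ∀ w ∈ s, -(sgn w * ∑ v, y v * A v w) = if w = i then 1 else 0 := by
  refine (Submodule.mem_span_range_iff_exists_fun ℤ).trans ?_
  refine exists_congr fun y => ?_
  have hout : ∀ w, w ∉ s → (∑ v, y v • relMat A sgn s v) w = y w := by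
    intro w hw
    rw [Finset.sum_apply, Finset.sum_eq_single w]
    · simp [relMat, hw]
    · intro v _ hv
      simp [relMat, hw, hv]
    · simp
  have hin : ∀ w ∈ s, (∑ v, y v • relMat A sgn s v) w = -(sgn w * ∑ v, y v * A v w) := by
    intro w hw
    rw [Finset.sum_apply, Finset.mul_sum, ← Finset.sum_neg_distrib]
    refine Finset.sum_congr rfl fun v _ => ?_
    have hvw : ¬ (v = w ∧ v ∉ s) := fun h => h.2 (h.1 ▸ hw)
    simp only [Pi.smul_apply, relMat, hvw, hw, if_true, if_false, smul_eq_mul]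
    ring
  rw [funext_iff]
  constructor
  · intro h
    refine ⟨fun w hw => ?_, fun w hw => ?_⟩
    · rw [← hout w hw, h w, Pi.single_apply]
    · rw [← hin w hw, h w, Pi.single_apply]
  · rintro ⟨h1, h2⟩ w
    rw [Pi.single_apply]
    by_cases hw : w ∈ s
    · rw [hin w hw, h2 w hw]
    · rw [hout w hw, h1 w hw]

theorem single_mem_span_relMat_iff_of_notMem (hskew : Aᵀ = -A)
    (hPU : ∀ s : Finset V,
      (A.submatrix (Subtype.val : {x // x ∈ s} → V) Subtype.val).det ∈ ({0, 1} : Set ℤ))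
    {sgn : V → ℤ} (hsgn : ∀ v, sgn v ≠ 0) {s : Finset V} {i : V} (hi : i ∉ s) :
    Pi.single i (1 : ℤ) ∈ Submodule.span ℤ (Set.range (relMat A sgn s)) ↔
      ∀ x ∈ principalKer A s, ∑ v, (A i v : ℚ) * x v = 0 := by
  rw [single_mem_span_relMat_iff]
  constructor
  · rintro ⟨y, hy, hyA⟩ x ⟨hx, hAx⟩
    have h := sum_vecMul_mul_eq_sum_mul_mulVec A y x
    rw [Finset.sum_eq_zero, Finset.sum_eq_single i] at h
    · rw [hy i hi] at h
      simpa using h.symm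
    · intro v _ hv
      by_cases hvs : v ∈ s
      · rw [hAx v hvs, mul_zero]
      · simp [hy v hvs, hv]
    · simp
    · intro w _
      by_cases hw : w ∈ s
      · have hwi : w ≠ i := fun h => hi (h ▸ hw)
        have := hyA w hw
        rw [if_neg hwi, neg_eq_zero] at this
        rw [(mul_eq_zero.1 this).resolve_left (hsgn w), Int.cast_zero, zero_mul]
      · rw [hx w hw, mul_zero]
  · intro h
    obtain ⟨z, hz, hzA⟩ := exists_int_combination_of_forall_principalKer hskew hPU s (A i) h
    refine ⟨Pi.single i 1 - z, fun w hw => ?_, fun w hw => ?_⟩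
    · simp [hz w hw, Pi.single_apply]
    · have hwi : w ≠ i := fun h => hi (h ▸ hw)
      simp [sub_mul, Finset.sum_sub_distrib, hzA w hw, Pi.single_apply, hwi]

theorem single_mem_span_relMat_iff_of_mem (hskew : Aᵀ = -A)
    (hPU : ∀ s : Finset V,
      (A.submatrix (Subtype.val : {x // x ∈ s} → V) Subtype.val).det ∈ ({0, 1} : Set ℤ))
    {sgn : V → ℤ} (hsgn : ∀ v, sgn v ≠ 0) {s : Finset V} {i : V} (hi : i ∈ s)
    (hsi : sgn i = 1) :
    Pi.single i (1 : ℤ) ∈ Submodule.span ℤ (Set.range (relMat A sgn s)) ↔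
      ∀ x ∈ principalKer A s, x i = 0 := by
  rw [single_mem_span_relMat_iff]
  constructor
  · rintro ⟨y, hy, hyA⟩ x ⟨hx, hAx⟩
    have h := sum_vecMul_mul_eq_sum_mul_mulVec A y x
    rw [Finset.sum_eq_single i, Finset.sum_eq_zero (f := fun v => (y v : ℚ) * _)] at h
    · have hyi := hyA i hi
      rw [if_pos rfl, hsi, one_mul, neg_eq_iff_eq_neg] at hyi
      rw [hyi] at h
      simpa using h
    · intro v _
      by_cases hvs : v ∈ s
      · rw [hAx v hvs, mul_zero]
      · have hvi : v ≠ i := fun h => hvs (h ▸ hi)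
        simp [hy v hvs, hvi]
    · intro w _ hwi
      by_cases hw : w ∈ s
      · have := hyA w hw
        rw [if_neg hwi, neg_eq_zero] at this
        rw [(mul_eq_zero.1 this).resolve_left (hsgn w), Int.cast_zero, zero_mul]
      · rw [hx w hw, mul_zero]
    · simp
  · intro h
    obtain ⟨z, hz, hzA⟩ := exists_int_combination_of_forall_principalKer hskew hPU s
      (Pi.single i 1) (fun x hx => by simpa [Pi.single_apply] using h x hx)
    refine ⟨-z, fun w hw => ?_, fun w hw => ?_⟩
    · have hwi : w ≠ i := fun h => hw (h ▸ hi)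
      simp [hz w hw, hwi]
    · simp only [Pi.neg_apply, neg_mul, Finset.sum_neg_distrib, hzA w hw, Pi.single_apply]
      by_cases hwi : w = i
      · simp [hwi, hsi]
      · simp [hwi]

end PrincipallyUnimodular

/-- for `i` as dictated by the sign (`i ∉ s` if `sgn i = -1`, `i ∈ s` if
`sgn i = 1`), `x_i = 0` in `V(s)` (i.e. `e_i` lies in the row span of `R(s)`) iff
`corank A(s ⊕ i) = corank A(s) + 1`. -/
theorem stmt12 {V₀ V₁ : Type*} [Fintype V₀] [Fintype V₁] [DecidableEq V₀] [DecidableEq V₁]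
    (A : Matrix (V₀ ⊕ V₁) (V₀ ⊕ V₁) ℤ) (hskew : Aᵀ = -A)
    (hent : ∀ i j, A i j ∈ ({-1, 0, 1} : Set ℤ))
    (hbip₀ : ∀ i j : V₀, A (Sum.inl i) (Sum.inl j) = 0)
    (hbip₁ : ∀ i j : V₁, A (Sum.inr i) (Sum.inr j) = 0)
    (hPU : ∀ s : Finset (V₀ ⊕ V₁),
      (A.submatrix (Subtype.val : {x // x ∈ s} → (V₀ ⊕ V₁)) Subtype.val).det
        ∈ ({0, 1} : Set ℤ))
    (sgn : V₀ ⊕ V₁ → ℤ) (hsgn : ∀ v, sgn v = 1 ∨ sgn v = -1)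
    (s : Finset (V₀ ⊕ V₁)) (i : V₀ ⊕ V₁)
    (hneg : sgn i = -1 → i ∉ s) (hpos : sgn i = 1 → i ∈ s) :
    Pi.single i (1 : ℤ) ∈ Submodule.span ℤ (Set.range (relMat A sgn s)) ↔
      pcorank A (stoggle s i) = pcorank A s + 1 := by
  have hsgn0 : ∀ v, sgn v ≠ 0 := fun v => by rcases hsgn v with h | h <;> omega
  rcases hsgn i with h1 | h1
  · have hi := hpos h1
    have hins := pcorank_eq_insert_add_one_iff hskew hPU (Finset.notMem_erase i s)
    rw [Finset.insert_erase hi] at hins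
    rw [single_mem_span_relMat_iff_of_mem hskew hPU hsgn0 hi h1, stoggle, if_pos hi, hins]
  · have hi := hneg h1
    rw [single_mem_span_relMat_iff_of_notMem hskew hPU hsgn0 hi, stoggle, if_neg hi,
      pcorank_insert_eq_add_one_iff hskew hPU hi]
end

section
/- Let V = V₀ ⊔ V₁ be a finite set, A a skew-symmetric integer matrix on V vanishing on V₀ × V₀ and V₁ × V₁, and sgn : V → {−1, 1}. Let i, j ∈ V₀ be distinct with sgn(i) = sgn(j) = −1, and let s ⊆ V be a state with i, j ∉ s. If α, β ∈ ℤ are such that e_i + α·e_j lies in the ℤ-span of the rows of R(s) and e_i + β·e_j lies in the ℤ-span of the rows of R(s ∪ {i, j}), then α·β = −1. -/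
open Matrix

/-- The `w`-coordinate of an integer combination of the rows of `relMat A sgn s`. -/
theorem sum_smul_relMat_apply {V : Type*} [Fintype V] [DecidableEq V] (A : Matrix V V ℤ)
    (sgn : V → ℤ) (s : Finset V) (c : V → ℤ) (w : V) :
    (∑ v, c v • relMat A sgn s v) w =
      if w ∈ s then -(sgn w * ∑ v, c v * A v w) else c w := by
  rw [Finset.sum_apply]
  split_ifs with h
  · rw [Finset.mul_sum, ← Finset.sum_neg_distrib]
    refine Finset.sum_congr rfl fun v _ => ?_
    have hv : ¬(v = w ∧ v ∉ s) := fun ⟨hvw, hvs⟩ => hvs (hvw ▸ h)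
    simp only [Pi.smul_apply, relMat, if_neg hv, if_pos h, smul_eq_mul]
    ring
  · rw [Finset.sum_eq_single w]
    · simp [relMat, h]
    · intro v _ hv
      simp [relMat, h, hv]
    · simp

/-- for distinct `i, j ∈ V₀` with `sgn i = sgn j = -1` and a state `s`
avoiding `i, j`, if `x_i + α x_j = 0` in `V(s)` and `x_i + β x_j = 0` in
`V(s ∪ {i, j})` then `α β = -1`. -/
theorem stmt15 {V₀ V₁ : Type*} [Fintype V₀] [Fintype V₁] [DecidableEq V₀] [DecidableEq V₁]
    (A : Matrix (V₀ ⊕ V₁) (V₀ ⊕ V₁) ℤ) (hskew : Aᵀ = -A)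
    (hbip₀ : ∀ i j : V₀, A (Sum.inl i) (Sum.inl j) = 0)
    (hbip₁ : ∀ i j : V₁, A (Sum.inr i) (Sum.inr j) = 0)
    (sgn : V₀ ⊕ V₁ → ℤ) (hsgn : ∀ v, sgn v = 1 ∨ sgn v = -1)
    (i j : V₀) (hij : i ≠ j)
    (hsi : sgn (Sum.inl i) = -1) (hsj : sgn (Sum.inl j) = -1)
    (s : Finset (V₀ ⊕ V₁)) (hi : Sum.inl i ∉ s) (hj : Sum.inl j ∉ s)
    (α β : ℤ)
    (hα : Pi.single (Sum.inl i) (1 : ℤ) + α • Pi.single (Sum.inl j) (1 : ℤ) ∈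
      Submodule.span ℤ (Set.range (relMat A sgn s)))
    (hβ : Pi.single (Sum.inl i) (1 : ℤ) + β • Pi.single (Sum.inl j) (1 : ℤ) ∈
      Submodule.span ℤ
        (Set.range (relMat A sgn (insert (Sum.inl i) (insert (Sum.inl j) s))))) :
    α * β = -1 := by
  obtain ⟨y, hy⟩ := (Submodule.mem_span_range_iff_exists_fun ℤ).1 hα
  obtain ⟨z, hz⟩ := (Submodule.mem_span_range_iff_exists_fun ℤ).1 hβ
  have hy' := fun w => (sum_smul_relMat_apply A sgn s y w).symm.trans (congrFun hy w)
  have hz' := fun w => (sum_smul_relMat_apply A sgn _ z w).symm.trans (congrFun hz w)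
  have hsgn0 : ∀ v, sgn v ≠ 0 := fun v => by rcases hsgn v with h | h <;> simp [h]
  have hyi : y (Sum.inl i) = 1 := by simpa [hi, hij] using hy' (Sum.inl i)
  have hyj : y (Sum.inl j) = α := by simpa [hj, hij.symm] using hy' (Sum.inl j)
  have hzi : ∑ w, z (Sum.inr w) * A (Sum.inr w) (Sum.inl i) = 1 := by
    simpa [hsi, hij, hbip₀] using hz' (Sum.inl i)
  have hzj : ∑ w, z (Sum.inr w) * A (Sum.inr w) (Sum.inl j) = β := by
    simpa [hsj, hij.symm, hbip₀] using hz' (Sum.inl j)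
  have hrest : ∀ v, v ≠ i → v ≠ j →
      (∑ w, z (Sum.inr w) * A (Sum.inr w) (Sum.inl v)) * y (Sum.inl v) = 0 := by
    intro v hvi hvj
    by_cases hv : Sum.inl v ∈ s
    · have h : ∑ w, z (Sum.inr w) * A (Sum.inr w) (Sum.inl v) = 0 := by
        simpa [hv, hvi, hvj, hbip₀, hsgn0] using hz' (Sum.inl v)
      rw [h, zero_mul]
    · have h : y (Sum.inl v) = 0 := by simpa [hv, hvi, hvj] using hy' (Sum.inl v)
      rw [h, mul_zero]
  have hright : ∀ w, z (Sum.inr w) * ∑ v, y (Sum.inl v) * A (Sum.inl v) (Sum.inr w) = 0 := by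
    intro w
    by_cases hw : Sum.inr w ∈ s
    · have h : ∑ v, y (Sum.inl v) * A (Sum.inl v) (Sum.inr w) = 0 := by
        simpa [hw, hbip₁, hsgn0] using hy' (Sum.inr w)
      rw [h, mul_zero]
    · have h : z (Sum.inr w) = 0 := by simpa [hw] using hz' (Sum.inr w)
      rw [h, zero_mul]
  have hleft : ∑ v, (∑ w, z (Sum.inr w) * A (Sum.inr w) (Sum.inl v)) * y (Sum.inl v) =
      1 + β * α := by
    rw [Fintype.sum_eq_add i j hij fun v hv => hrest v hv.1 hv.2, hzi, hzj, hyi, hyj, one_mul]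
  have hpair : ∑ v, (∑ w, z (Sum.inr w) * A (Sum.inr w) (Sum.inl v)) * y (Sum.inl v) =
      -∑ w, z (Sum.inr w) * ∑ v, y (Sum.inl v) * A (Sum.inl v) (Sum.inr w) := by
    simp only [Finset.sum_mul, Finset.mul_sum, ← Finset.sum_neg_distrib]
    rw [Finset.sum_comm]
    refine Finset.sum_congr rfl fun w _ => Finset.sum_congr rfl fun v _ => ?_
    have h : A (Sum.inr w) (Sum.inl v) = -A (Sum.inl v) (Sum.inr w) :=
      congrFun (congrFun hskew (Sum.inl v)) (Sum.inr w)
    rw [h]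
    ring
  rw [hleft, Finset.sum_eq_zero fun w _ => hright w] at hpair
  linarith
end

section
/- Let V = V₀ ⊔ V₁ be a finite set, A a skew-symmetric integer matrix on V vanishing on V₀ × V₀ and V₁ × V₁, and sgn : V → {−1, 1}. Let i ∈ V₀ with sgn(i) = −1, let j ∈ V₁ with sgn(j) = 1, and let s ⊆ V be a state with i ∉ s and j ∈ s; put s' = (s ∪ {i}) \ {j}. If α, β ∈ ℤ are such that e_i + α·e_j lies in the ℤ-span of the rows of R(s) and e_i + β·e_j lies in the ℤ-span of the rows of R(s'), then α·β = 1. -/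
open Matrix

theorem sum_smul_relMat_of_mem {V : Type*} [Fintype V] [DecidableEq V] (A : Matrix V V ℤ)
    (sgn : V → ℤ) {s : Finset V} (c : V → ℤ) {w : V} (hw : w ∈ s) :
    (∑ v, c v • relMat A sgn s v) w = -(sgn w * ∑ v, c v * A v w) := by
  rw [Finset.sum_apply, Finset.mul_sum, ← Finset.sum_neg_distrib]
  refine Finset.sum_congr rfl fun v _ => ?_
  have h : ¬(v = w ∧ v ∉ s) := by rintro ⟨rfl, h⟩; exact h hw
  simp only [Pi.smul_apply, smul_eq_mul, relMat, if_neg h, if_pos hw]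
  ring

theorem sum_smul_relMat_of_notMem {V : Type*} [Fintype V] [DecidableEq V] (A : Matrix V V ℤ)
    (sgn : V → ℤ) {s : Finset V} (c : V → ℤ) {w : V} (hw : w ∉ s) :
    (∑ v, c v • relMat A sgn s v) w = c w := by
  rw [Finset.sum_apply, Finset.sum_eq_single w]
  · simp [relMat, hw]
  · intro v _ hv
    simp [relMat, hw, hv]
  · simp

/-- for `i ∈ V₀` with `sgn i = -1`, `j ∈ V₁` with `sgn j = 1`, and a
state `s` with `i ∉ s`, `j ∈ s`, set `s' = (s ∪ {i}) \ {j}`; if `x_i + α x_j = 0` in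
`V(s)` and `x_i + β x_j = 0` in `V(s')`, then `α β = 1`. -/
theorem stmt16 {V₀ V₁ : Type*} [Fintype V₀] [Fintype V₁] [DecidableEq V₀] [DecidableEq V₁]
    (A : Matrix (V₀ ⊕ V₁) (V₀ ⊕ V₁) ℤ) (hskew : Aᵀ = -A)
    (hbip₀ : ∀ i j : V₀, A (Sum.inl i) (Sum.inl j) = 0)
    (hbip₁ : ∀ i j : V₁, A (Sum.inr i) (Sum.inr j) = 0)
    (sgn : V₀ ⊕ V₁ → ℤ) (hsgn : ∀ v, sgn v = 1 ∨ sgn v = -1)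
    (i : V₀) (j : V₁)
    (hsi : sgn (Sum.inl i) = -1) (hsj : sgn (Sum.inr j) = 1)
    (s : Finset (V₀ ⊕ V₁)) (hi : Sum.inl i ∉ s) (hj : Sum.inr j ∈ s)
    (α β : ℤ)
    (hα : Pi.single (Sum.inl i) (1 : ℤ) + α • Pi.single (Sum.inr j) (1 : ℤ) ∈
      Submodule.span ℤ (Set.range (relMat A sgn s)))
    (hβ : Pi.single (Sum.inl i) (1 : ℤ) + β • Pi.single (Sum.inr j) (1 : ℤ) ∈
      Submodule.span ℤ
        (Set.range (relMat A sgn (insert (Sum.inl i) (s.erase (Sum.inr j)))))) :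
    α * β = 1 := by
  obtain ⟨c, hc⟩ := (Submodule.mem_span_range_iff_exists_fun ℤ).1 hα
  obtain ⟨d, hd⟩ := (Submodule.mem_span_range_iff_exists_fun ℤ).1 hβ
  have hA (x : V₀) (y : V₁) : A (Sum.inl x) (Sum.inr y) = -A (Sum.inr y) (Sum.inl x) :=
    congrFun (congrFun hskew (Sum.inr y)) (Sum.inl x)
  have hsgn0 (v) : sgn v ≠ 0 := by rcases hsgn v with h | h <;> simp [h]
  have hc1 : c (Sum.inl i) = 1 := by
    rw [← sum_smul_relMat_of_notMem A sgn c hi, hc]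
    simp
  have hc0 (x : V₀) (hx : x ≠ i) (hxs : Sum.inl x ∉ s) : c (Sum.inl x) = 0 := by
    rw [← sum_smul_relMat_of_notMem A sgn c hxs, hc]
    simp [hx]
  have hcj : ∑ x : V₀, c (Sum.inl x) * A (Sum.inl x) (Sum.inr j) = -α := by
    have h := sum_smul_relMat_of_mem A sgn c hj
    rw [hc] at h
    simp [hsj, hbip₁] at h
    linarith
  have hcA (y : V₁) (hy : y ≠ j) (hys : Sum.inr y ∈ s) :
      ∑ x : V₀, c (Sum.inl x) * A (Sum.inl x) (Sum.inr y) = 0 := by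
    have h := sum_smul_relMat_of_mem A sgn c hys
    rw [hc] at h
    simpa [hbip₁, hy, hsgn0] using h
  have hd1 : d (Sum.inr j) = β := by
    rw [← sum_smul_relMat_of_notMem A sgn d
      (s := insert (Sum.inl i) (s.erase (Sum.inr j))) (by simp), hd]
    simp
  have hd0 (y : V₁) (hy : y ≠ j) (hys : Sum.inr y ∉ s) : d (Sum.inr y) = 0 := by
    rw [← sum_smul_relMat_of_notMem A sgn d
      (s := insert (Sum.inl i) (s.erase (Sum.inr j))) (by simp [hys]), hd]
    simp [hy]
  have hdi : ∑ y : V₁, d (Sum.inr y) * A (Sum.inr y) (Sum.inl i) = 1 := by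
    have h := sum_smul_relMat_of_mem A sgn d
      (Finset.mem_insert_self (Sum.inl i) (s.erase (Sum.inr j)))
    rw [hd] at h
    simp [hsi, hbip₀] at h
    linarith
  have hdA (x : V₀) (hx : x ≠ i) (hxs : Sum.inl x ∈ s) :
      ∑ y : V₁, d (Sum.inr y) * A (Sum.inr y) (Sum.inl x) = 0 := by
    have h := sum_smul_relMat_of_mem A sgn d
      (s := insert (Sum.inl i) (s.erase (Sum.inr j))) (w := Sum.inl x) (by simp [hxs])
    rw [hd] at h
    simpa [hbip₀, hx, hsgn0] using h
  have h₁ : ∑ y : V₁, (∑ x : V₀, c (Sum.inl x) * A (Sum.inl x) (Sum.inr y)) * d (Sum.inr y) =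
      -α * β := by
    rw [Finset.sum_eq_single j, hcj, hd1]
    · intro y _ hy
      by_cases hys : Sum.inr y ∈ s
      · rw [hcA y hy hys, zero_mul]
      · rw [hd0 y hy hys, mul_zero]
    · simp
  have h₂ : ∑ x : V₀, (∑ y : V₁, d (Sum.inr y) * A (Sum.inr y) (Sum.inl x)) * c (Sum.inl x) =
      1 := by
    rw [Finset.sum_eq_single i, hdi, hc1, mul_one]
    · intro x _ hx
      by_cases hxs : Sum.inl x ∈ s
      · rw [hdA x hx hxs, zero_mul]
      · rw [hc0 x hx hxs, mul_zero]
    · simp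
  have h₃ : ∑ y : V₁, (∑ x : V₀, c (Sum.inl x) * A (Sum.inl x) (Sum.inr y)) * d (Sum.inr y) =
      -∑ x : V₀, (∑ y : V₁, d (Sum.inr y) * A (Sum.inr y) (Sum.inl x)) * c (Sum.inl x) := by
    simp_rw [Finset.sum_mul, ← Finset.sum_neg_distrib]
    rw [Finset.sum_comm]
    refine Finset.sum_congr rfl fun x _ => Finset.sum_congr rfl fun y _ => ?_
    rw [hA]
    ring
  linarith
end

section
/- Let V = V₀ ⊔ V₁ be a finite set, A a skew-symmetric integer matrix on V with entries in {−1, 0, 1} vanishing on V₀ × V₀ and V₁ × V₁, and sgn : V → {−1, 1}. Call v ∈ V inner if (v ∈ V₀ and sgn(v) = −1) or (v ∈ V₁ and sgn(v) = 1), and outer otherwise. Let i, j ∈ V be distinct, let s ⊆ V \ {i, j}, and let s₀ = s ∪ {k ∈ {i, j} : sgn(k) = 1} be the base corner of the 2-face spanned by i and j. Then: (1) if corank A(s₀ ⊕ i) = corank A(s₀) − 1, corank A(s₀ ⊕ j) = corank A(s₀) − 1 and corank A(s₀ ⊕ i ⊕ j) = corank A(s₀) (a 2-face of type 5), then i and j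 are either both inner or both outer; (2) if corank A(s₀ ⊕ i) = corank A(s₀) + 1, corank A(s₀ ⊕ j) = corank A(s₀) + 1 and corank A(s₀ ⊕ i ⊕ j) = corank A(s₀) (a 2-face of type 4), then exactly one of i, j is inner. -/
open Matrix

/-- A vertex is `inner` if it lies in `V₀` with sign `-1` or in `V₁` with sign `1`. -/
def IsInner {V₀ V₁ : Type*} (sgn : V₀ ⊕ V₁ → ℤ) : V₀ ⊕ V₁ → Prop
  | .inl v => sgn (.inl v) = -1
  | .inr v => sgn (.inr v) = 1

namespace Matrix

variable {K m n : Type*} [Field K]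

/-- The rank of an off-diagonal block matrix is the sum of the ranks of its blocks. -/
theorem rank_fromBlocks_zero_diag {m' n' : Type*} [Fintype n] [Fintype n'] [Finite m] [Finite m']
    (B : Matrix m n' K) (C : Matrix m' n K) :
    (fromBlocks 0 B C 0).rank = B.rank + C.rank := by
  have hrange : LinearMap.range (fromBlocks 0 B C 0).mulVecLin =
      ((LinearMap.range B.mulVecLin).prod (LinearMap.range C.mulVecLin)).map
        ((LinearEquiv.sumArrowLequivProdArrow m m' K K).symm : _ →ₗ[K] (m ⊕ m' → K)) := by
    ext x
    constructor
    · rintro ⟨v, rfl⟩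
      refine ⟨(B *ᵥ (v ∘ Sum.inr), C *ᵥ (v ∘ Sum.inl)), ⟨⟨_, rfl⟩, ⟨_, rfl⟩⟩, ?_⟩
      ext k
      rcases k with k | k <;> simp [fromBlocks_mulVec]
    · rintro ⟨⟨_, _⟩, ⟨⟨v, rfl⟩, ⟨w, rfl⟩⟩, rfl⟩
      refine ⟨Sum.elim w v, ?_⟩
      ext k
      rcases k with k | k <;> simp [fromBlocks_mulVec]
  have hprod : (LinearMap.range B.mulVecLin).prod (LinearMap.range C.mulVecLin) =
      LinearMap.range ((LinearMap.range B.mulVecLin).subtype.prodMap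
        (LinearMap.range C.mulVecLin).subtype) := by
    rw [LinearMap.range_prodMap, Submodule.range_subtype, Submodule.range_subtype]
  rw [rank, hrange, LinearEquiv.finrank_map_eq, hprod, LinearMap.finrank_range_of_inj
    (Subtype.val_injective.prodMap Subtype.val_injective), Module.finrank_prod, rank, rank]

/-- The row space of the submatrix of `B` with rows `S` and columns `T`. -/
def subRowSpace (B : Matrix m n K) (S : Finset m) (T : Finset n) : Submodule K (T → K) :=
  Submodule.span K ((fun a (b : T) => B a b) '' S)

/-- The rank of the submatrix of `B` with rows `S` and columns `T`. -/
noncomputable def subRank (B : Matrix m n K) (S : Finset m) (T : Finset n) : ℕ :=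
  (B.submatrix (Subtype.val : S → m) (Subtype.val : T → n)).rank

theorem subRank_eq_finrank (B : Matrix m n K) (S : Finset m) (T : Finset n) :
    B.subRank S T = Module.finrank K (B.subRowSpace S T) := by
  rw [subRank, rank_eq_finrank_span_row, subRowSpace]
  have hrows : Set.range (B.submatrix (Subtype.val : S → m) (Subtype.val : T → n)).row =
      (fun a (b : T) => B a b) '' S := by
    ext x
    simp [row_apply, funext_iff]
  rw [hrows]

theorem subRank_transpose (B : Matrix m n K) (S : Finset m) (T : Finset n) :
    Bᵀ.subRank T S = B.subRank S T := by
  rw [subRank, subRank, ← rank_transpose]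
  rfl

theorem subRowSpace_mono_left (B : Matrix m n K) {S S' : Finset m} (h : S ⊆ S') (T : Finset n) :
    B.subRowSpace S T ≤ B.subRowSpace S' T :=
  Submodule.span_mono (Set.image_mono (by exact_mod_cast h))

theorem restrict_mem_subRowSpace {B : Matrix m n K} {a : m} {S : Finset m} {T T' : Finset n}
    (hT : T ⊆ T') (h : (fun b : T' => B a b) ∈ B.subRowSpace S T') :
    (fun b : T => B a b) ∈ B.subRowSpace S T := by
  have := Submodule.mem_map_of_mem (f := LinearMap.funLeft K K (fun b : T => (⟨b, hT b.2⟩ : T'))) h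
  rw [subRowSpace, Submodule.map_span, ← Set.image_comp] at this
  exact this

variable [DecidableEq m]

theorem subRowSpace_insert (B : Matrix m n K) (a : m) (S : Finset m) (T : Finset n) :
    B.subRowSpace (insert a S) T = B.subRowSpace S T ⊔ Submodule.span K {fun b : T => B a b} := by
  rw [subRowSpace, Finset.coe_insert, Set.image_insert_eq, Submodule.span_insert, sup_comm,
    subRowSpace]

theorem subRank_insert_of_mem {B : Matrix m n K} {a : m} {S : Finset m} {T : Finset n}
    (h : (fun b : T => B a b) ∈ B.subRowSpace S T) : B.subRank (insert a S) T = B.subRank S T := by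
  rw [subRank_eq_finrank, subRowSpace_insert, sup_eq_left.2, subRank_eq_finrank]
  simpa using h

theorem subRank_insert_of_notMem {B : Matrix m n K} {a : m} {S : Finset m} {T : Finset n}
    (h : (fun b : T => B a b) ∉ B.subRowSpace S T) :
    B.subRank (insert a S) T = B.subRank S T + 1 := by
  rw [subRank_eq_finrank, subRowSpace_insert, Submodule.finrank_sup_span_singleton h,
    subRank_eq_finrank]

theorem subRank_insert_eq_iff {B : Matrix m n K} {a : m} {S : Finset m} {T : Finset n} :
    B.subRank (insert a S) T = B.subRank S T ↔ (fun b : T => B a b) ∈ B.subRowSpace S T := by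
  refine ⟨fun h => ?_, subRank_insert_of_mem⟩
  by_contra hn
  have := subRank_insert_of_notMem hn
  omega

/-- If adjoining either of two rows preserves the rank, so does adjoining both. -/
theorem subRank_insert_insert_of_eq {B : Matrix m n K} {a a' : m} {S : Finset m} {T : Finset n}
    (h : B.subRank (insert a S) T = B.subRank S T)
    (h' : B.subRank (insert a' S) T = B.subRank S T) :
    B.subRank (insert a' (insert a S)) T = B.subRank S T := by
  rw [subRank_insert_of_mem, h]
  exact B.subRowSpace_mono_left (Finset.subset_insert a S) T (subRank_insert_eq_iff.1 h')

/-- If adjoining a row and adjoining a column both raise the rank, adjoining both raises it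
twice. -/
theorem subRank_insert_insert_of_ne [DecidableEq n] {B : Matrix m n K} {a : m} {b : n} {S : Finset m}
    {T : Finset n} (h : B.subRank (insert a S) T ≠ B.subRank S T)
    (h' : B.subRank S (insert b T) = B.subRank S T + 1) :
    B.subRank (insert a S) (insert b T) = B.subRank S T + 2 := by
  rw [subRank_insert_of_notMem, h']
  exact fun hm => h (subRank_insert_of_mem (restrict_mem_subRowSpace (Finset.subset_insert b T) hm))

end Matrix

section Bipartite

variable {V₀ V₁ : Type*} [DecidableEq V₀] [DecidableEq V₁]

/-- The off-diagonal block of an integer matrix indexed by `V₀ ⊕ V₁`, over `ℚ`. -/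
def ratBlock (A : Matrix (V₀ ⊕ V₁) (V₀ ⊕ V₁) ℤ) : Matrix V₀ V₁ ℚ :=
  A.toBlocks₁₂.map (Int.cast : ℤ → ℚ)

theorem pcorank_eq_card_sub_subRank {A : Matrix (V₀ ⊕ V₁) (V₀ ⊕ V₁) ℤ} (hskew : Aᵀ = -A)
    (hbip₀ : ∀ i j : V₀, A (Sum.inl i) (Sum.inl j) = 0)
    (hbip₁ : ∀ i j : V₁, A (Sum.inr i) (Sum.inr j) = 0) (s : Finset (V₀ ⊕ V₁)) :
    pcorank A s = s.card - 2 * (ratBlock A).subRank s.toLeft s.toRight := by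
  have hrank : Matrix.rank (Matrix.map
      (A.submatrix (Subtype.val : {x // x ∈ s} → V₀ ⊕ V₁) (Subtype.val : {x // x ∈ s} → V₀ ⊕ V₁))
      (Int.cast : ℤ → ℚ)) = 2 * (ratBlock A).subRank s.toLeft s.toRight := by
    let e : s.toLeft ⊕ s.toRight ≃ {x // x ∈ s} :=
      ((Equiv.subtypeEquivRight fun _ => Finset.mem_toLeft).sumCongr
        (Equiv.subtypeEquivRight fun _ => Finset.mem_toRight)).trans Equiv.subtypeSum.symm
    let B := (ratBlock A).submatrix (Subtype.val : s.toLeft → V₀) (Subtype.val : s.toRight → V₁)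
    have hblocks : (Matrix.map (A.submatrix (Subtype.val : {x // x ∈ s} → V₀ ⊕ V₁)
        (Subtype.val : {x // x ∈ s} → V₀ ⊕ V₁)) (Int.cast : ℤ → ℚ)).submatrix e e =
          fromBlocks 0 B (-Bᵀ) 0 := by
      ext x y
      rcases x with x | x <;> rcases y with y | y
      · simp [e, Equiv.subtypeSum, hbip₀]
      · simp [e, Equiv.subtypeSum, B, ratBlock, toBlocks₁₂]
      · have := congrFun (congrFun hskew (Sum.inr x.1)) (Sum.inl y.1)
        simp only [transpose_apply, neg_apply] at this
        simp [e, Equiv.subtypeSum, B, ratBlock, toBlocks₁₂, this]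
      · simp [e, Equiv.subtypeSum, hbip₁]
    have hneg : (-Bᵀ).rank = B.rank := by
      rw [← rank_transpose B, ← neg_one_smul ℚ Bᵀ,
        rank_smul_of_mem_nonZeroDivisors _ (by simp)]
    rw [← rank_submatrix _ e e, hblocks, rank_fromBlocks_zero_diag, hneg, two_mul]
    rfl
  rw [pcorank, hrank]
  push_cast
  rfl

/-- If adjoining either of two vertices on the same side raises the corank, adjoining both raises
it twice. -/
theorem pcorank_insert_insert_of_isLeft_eq {A : Matrix (V₀ ⊕ V₁) (V₀ ⊕ V₁) ℤ} (hskew : Aᵀ = -A)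
    (hbip₀ : ∀ i j : V₀, A (Sum.inl i) (Sum.inl j) = 0)
    (hbip₁ : ∀ i j : V₁, A (Sum.inr i) (Sum.inr j) = 0) {s : Finset (V₀ ⊕ V₁)} {i j : V₀ ⊕ V₁}
    (hij : i ≠ j) (hi : i ∉ s) (hj : j ∉ s) (hside : i.isLeft = j.isLeft)
    (h : pcorank A (insert i s) = pcorank A s + 1)
    (h' : pcorank A (insert j s) = pcorank A s + 1) :
    pcorank A (insert j (insert i s)) = pcorank A s + 2 := by
  have hji : j ∉ insert i s := by simp [hj, hij.symm]
  simp only [pcorank_eq_card_sub_subRank hskew hbip₀ hbip₁, Finset.card_insert_of_notMem hi,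
    Finset.card_insert_of_notMem hj, Finset.card_insert_of_notMem hji] at *
  rcases i with i | i <;> rcases j with j | j <;> simp at hside <;>
    simp only [Finset.toLeft_insert_inl, Finset.toLeft_insert_inr, Finset.toRight_insert_inl,
      Finset.toRight_insert_inr, ← subRank_transpose (ratBlock A)] at *
  · simp only [subRank_transpose] at *
    rw [subRank_insert_insert_of_eq (by omega) (by omega)]
    omega
  · rw [subRank_insert_insert_of_eq (by omega) (by omega)]
    omega

/-- If adjoining either of two vertices on opposite sides lowers the corank, adjoining both lowers
it twice. -/
theorem pcorank_insert_insert_of_isLeft_ne {A : Matrix (V₀ ⊕ V₁) (V₀ ⊕ V₁) ℤ} (hskew : Aᵀ = -A)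
    (hbip₀ : ∀ i j : V₀, A (Sum.inl i) (Sum.inl j) = 0)
    (hbip₁ : ∀ i j : V₁, A (Sum.inr i) (Sum.inr j) = 0) {s : Finset (V₀ ⊕ V₁)} {i j : V₀ ⊕ V₁}
    (hij : i ≠ j) (hi : i ∉ s) (hj : j ∉ s) (hside : i.isLeft ≠ j.isLeft)
    (h : pcorank A (insert i s) = pcorank A s - 1)
    (h' : pcorank A (insert j s) = pcorank A s - 1) :
    pcorank A (insert j (insert i s)) = pcorank A s - 2 := by
  have hji : j ∉ insert i s := by simp [hj, hij.symm]
  simp only [pcorank_eq_card_sub_subRank hskew hbip₀ hbip₁, Finset.card_insert_of_notMem hi,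
    Finset.card_insert_of_notMem hj, Finset.card_insert_of_notMem hji] at *
  rcases i with i | i <;> rcases j with j | j <;> simp at hside <;>
    simp only [Finset.toLeft_insert_inl, Finset.toLeft_insert_inr, Finset.toRight_insert_inl,
      Finset.toRight_insert_inr] at *
  all_goals
    rw [subRank_insert_insert_of_ne (by omega) (by omega)]
    omega

end Bipartite

/-- on a 2-face of the state hypercube spanned by `i, j` with base
corner `s₀ = s ∪ {k ∈ {i, j} : sgn k = 1}`:
(1) on a face of type 5 (coranks drop by one in both directions and return at the
far corner), `i` and `j` are both inner or both outer;
(2) on a face of type 4 (coranks rise by one in both directions and return at the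
far corner), exactly one of `i, j` is inner. -/
theorem stmt17 {V₀ V₁ : Type*} [Fintype V₀] [Fintype V₁] [DecidableEq V₀] [DecidableEq V₁]
    (A : Matrix (V₀ ⊕ V₁) (V₀ ⊕ V₁) ℤ) (hskew : Aᵀ = -A)
    (hent : ∀ i j, A i j ∈ ({-1, 0, 1} : Set ℤ))
    (hbip₀ : ∀ i j : V₀, A (Sum.inl i) (Sum.inl j) = 0)
    (hbip₁ : ∀ i j : V₁, A (Sum.inr i) (Sum.inr j) = 0)
    (sgn : V₀ ⊕ V₁ → ℤ) (hsgn : ∀ v, sgn v = 1 ∨ sgn v = -1)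
    (i j : V₀ ⊕ V₁) (hij : i ≠ j)
    (s : Finset (V₀ ⊕ V₁)) (hi : i ∉ s) (hj : j ∉ s)
    (s₀ : Finset (V₀ ⊕ V₁))
    (hs₀ : s₀ = s ∪ ({i, j} : Finset (V₀ ⊕ V₁)).filter (fun k => sgn k = 1)) :
    ((pcorank A (stoggle s₀ i) = pcorank A s₀ - 1 ∧
      pcorank A (stoggle s₀ j) = pcorank A s₀ - 1 ∧
      pcorank A (stoggle (stoggle s₀ i) j) = pcorank A s₀) →
        (IsInner sgn i ↔ IsInner sgn j)) ∧
    ((pcorank A (stoggle s₀ i) = pcorank A s₀ + 1 ∧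
      pcorank A (stoggle s₀ j) = pcorank A s₀ + 1 ∧
      pcorank A (stoggle (stoggle s₀ i) j) = pcorank A s₀) →
        (IsInner sgn i ↔ ¬ IsInner sgn j)) := by
  have same (hside : i.isLeft = j.isLeft) :=
    pcorank_insert_insert_of_isLeft_eq hskew hbip₀ hbip₁ hij hi hj hside
  have opp (hside : i.isLeft ≠ j.isLeft) :=
    pcorank_insert_insert_of_isLeft_ne hskew hbip₀ hbip₁ hij hi hj hside
  have hinner (v) : IsInner sgn v ↔ (v.isLeft = true ↔ sgn v = -1) := by
    have := hsgn v
    rcases v with v | v <;> simp [IsInner]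
    grind
  rw [hinner, hinner]
  rcases hsgn i with hsi | hsi <;> rcases hsgn j with hsj | hsj
  · have e₀ : s₀ = insert j (insert i s) := by grind
    have e₁ : stoggle s₀ i = insert j s := by grind [stoggle]
    have e₂ : stoggle s₀ j = insert i s := by grind [stoggle]
    have e₃ : stoggle (stoggle s₀ i) j = s := by grind [stoggle]
    rw [e₃, e₁, e₂, e₀]
    grind
  · have e₀ : s₀ = insert i s := by grind
    have e₁ : stoggle s₀ i = s := by grind [stoggle]
    have e₂ : stoggle s₀ j = insert j (insert i s) := by grind [stoggle]
    have e₃ : stoggle (stoggle s₀ i) j = insert j s := by grind [stoggle]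
    rw [e₃, e₁, e₂, e₀]
    grind
  · have e₀ : s₀ = insert j s := by grind
    have e₁ : stoggle s₀ i = insert j (insert i s) := by grind [stoggle]
    have e₂ : stoggle s₀ j = s := by grind [stoggle]
    have e₃ : stoggle (stoggle s₀ i) j = insert i s := by grind [stoggle]
    rw [e₃, e₁, e₂, e₀]
    grind
  · have e₀ : s₀ = s := by grind
    have e₁ : stoggle s₀ i = insert i s := by grind [stoggle]
    have e₂ : stoggle s₀ j = insert j s := by grind [stoggle]
    have e₃ : stoggle (stoggle s₀ i) j = insert j (insert i s) := by grind [stoggle]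
    rw [e₃, e₁, e₂, e₀]
    grind
end

section
/- Let V = V₀ ⊔ V₁ be a finite set, A a skew-symmetric integer matrix on V vanishing on V₀ × V₀ and V₁ × V₁ all of whose minors lie in {−1, 0, 1} (so that all the modules V(s) are free), and sgn : V → {−1, 1}. Let i, j ∈ V₀ be distinct with sgn(i) = sgn(j) = −1, and let s ⊆ V be a state with i, j ∉ s. Suppose e_i lies in the ℤ-span of the rows of R(s ∪ {i}), e_j lies in the ℤ-span of the rows of R(s ∪ {j}), and neither e_i nor e_j lies in the ℤ-span of the rows of R(s ∪ {i, j}). Then there exists ε ∈ {−1, 1} such that e_i + ε·e_j lies in the ℤ-span of the rows of R(s ∪ {i, j}). -/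
open Matrix

namespace Matrix

/-- The row lattice of a totally unimodular matrix is saturated. -/
theorem IsTotallyUnimodular.mem_span_of_smul_mem_span {m n : Type*} [Fintype m] [Fintype n]
    {M : Matrix m n ℤ} (hM : M.IsTotallyUnimodular) {N : ℤ} (hN : N ≠ 0) {v : n → ℤ}
    (hv : N • v ∈ Submodule.span ℤ (Set.range M)) : v ∈ Submodule.span ℤ (Set.range M) := by
  set Q : Matrix m n ℚ := M.map (Int.cast : ℤ → ℚ) with hQ
  -- Over `ℚ`, the vector `v` lies in the span of the rows.
  have hvQ : (fun w ↦ (v w : ℚ)) ∈ Submodule.span ℚ (Set.range Q) := by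
    obtain ⟨y, hy⟩ := (Submodule.mem_span_range_iff_exists_fun ℤ).1 hv
    refine (Submodule.mem_span_range_iff_exists_fun ℚ).2 ⟨fun k ↦ (y k : ℚ) / N, funext fun w ↦ ?_⟩
    have hw : ∑ k, (y k : ℚ) * M k w = N * v w := by
      have := congrFun hy w
      simp only [Finset.sum_apply, Pi.smul_apply, smul_eq_mul] at this
      exact_mod_cast this
    have hNQ : (N : ℚ) ≠ 0 := by exact_mod_cast hN
    simp only [Finset.sum_apply, Pi.smul_apply, smul_eq_mul, hQ, map_apply, div_mul_eq_mul_div,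
      ← Finset.sum_div]
    rw [hw, mul_div_cancel_left₀ _ hNQ]
  -- Choose a basis of the row space among the rows, then as many independent columns.
  have hrows := Submodule.exists_fun_fin_finrank_span_eq ℚ (Set.range Q)
  generalize Module.finrank ℚ (Submodule.span ℚ (Set.range Q)) = r at hrows
  obtain ⟨f, hf, hspan, hli⟩ := hrows
  choose a ha using hf
  set C : Matrix (Fin r) n ℚ := Q.submatrix a id with hC
  have hfC : f = C.row := funext fun k ↦ (ha k).symm
  have hcols := Submodule.exists_fun_fin_finrank_span_eq ℚ (Set.range C.col)
  have hr : Module.finrank ℚ (Submodule.span ℚ (Set.range C.col)) = r := by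
    rw [← rank_eq_finrank_span_cols, LinearIndependent.rank_matrix (hfC ▸ hli), Fintype.card_fin]
  rw [hr] at hcols
  obtain ⟨g, hg, -, hgli⟩ := hcols
  choose b hb using hg
  set D : Matrix (Fin r) (Fin r) ℤ := M.submatrix a b with hD
  have hDQ : D.map (Int.cast : ℤ → ℚ) = C.submatrix id b := rfl
  have hdetQ : IsUnit (C.submatrix id b) := by
    rw [← linearIndependent_cols_iff_isUnit]
    rwa [← funext hb] at hgli
  have hdet0 : D.det ≠ 0 := by
    intro h
    have h0 : (C.submatrix id b).det = 0 := by
      rw [← hDQ]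
      have := (Int.castRingHom ℚ).map_det D
      rw [h, map_zero] at this
      exact this.symm
    exact ((isUnit_iff_isUnit_det _).1 hdetQ).ne_zero h0
  have hdet : IsUnit D.det := by
    obtain ⟨t, ht⟩ := (isTotallyUnimodular_iff M).1 hM r a b
    change _ = D.det at ht
    rw [← ht] at hdet0 ⊢
    clear ht
    cases t <;> simp at hdet0 ⊢
  -- The coefficients of `v` on the chosen rows are integral by Cramer's rule.
  rw [← hspan, hfC] at hvQ
  obtain ⟨z, hz⟩ := (Submodule.mem_span_range_iff_exists_fun ℚ).1 hvQ
  set x : Fin r → ℤ := (v ∘ b) ᵥ* D⁻¹ with hx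
  have hxD : x ᵥ* D = v ∘ b := by
    rw [hx, vecMul_vecMul, nonsing_inv_mul _ hdet, vecMul_one]
  have hzx : z = fun k ↦ (x k : ℚ) := by
    apply vecMul_injective_of_isUnit hdetQ
    funext l
    have h1 := congrFun hz (b l)
    have h2 := congrFun hxD l
    simp only [vecMul, dotProduct, Finset.sum_apply, Pi.smul_apply, smul_eq_mul,
      Function.comp_apply] at h1 h2 ⊢
    refine h1.trans ?_
    rw [← h2, Int.cast_sum]
    exact Finset.sum_congr rfl fun k _ ↦ Int.cast_mul _ _
  have hxv : ∑ k, x k • M (a k) = v := by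
    funext w
    have h1 := congrFun hz w
    simp only [hzx, Finset.sum_apply, Pi.smul_apply, smul_eq_mul] at h1 ⊢
    have h2 : ∑ k, (x k : ℚ) * (M (a k) w : ℚ) = v w := h1
    exact_mod_cast h2
  rw [← hxv]
  exact Submodule.sum_mem _ fun k _ ↦ Submodule.smul_mem _ _ (Submodule.subset_span ⟨a k, rfl⟩)

/-- If two matrices agree outside column `j`, every element of the row lattice of the first lies
in the row lattice of the second up to a multiple of the `j`-th basis vector. -/
theorem exists_add_smul_single_mem_span {m n : Type*} [Fintype m] [DecidableEq n]
    {M M' : Matrix m n ℤ} (j : n) (h : ∀ k, ∀ w ≠ j, M k w = M' k w) {x : n → ℤ}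
    (hx : x ∈ Submodule.span ℤ (Set.range M)) :
    ∃ a : ℤ, x + a • Pi.single j (1 : ℤ) ∈ Submodule.span ℤ (Set.range M') := by
  obtain ⟨c, rfl⟩ := (Submodule.mem_span_range_iff_exists_fun ℤ).1 hx
  refine ⟨∑ k, c k * (M' k j - M k j),
    (Submodule.mem_span_range_iff_exists_fun ℤ).2 ⟨c, funext fun w ↦ ?_⟩⟩
  by_cases hw : w = j
  · subst hw
    simp [Finset.sum_apply, mul_sub]
  · simp [Finset.sum_apply, hw, h _ w hw]

/-- Rescaling columns by signs preserves total unimodularity. -/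
theorem IsTotallyUnimodular.mul_col_sign {m n : Type*} {M : Matrix m n ℤ}
    (hM : M.IsTotallyUnimodular) {σ : n → ℤ} (hσ : ∀ w, σ w = 1 ∨ σ w = -1) :
    (of fun k w ↦ σ w * M k w).IsTotallyUnimodular := by
  intro k f g hf hg
  have hdet : ((of fun k w ↦ σ w * M k w).submatrix f g).det =
      (∏ l, σ (g l)) * (M.submatrix f g).det :=
    det_mul_row (fun l ↦ σ (g l)) (M.submatrix f g)
  have hprod : (∏ l, σ (g l)) = 1 ∨ (∏ l, σ (g l)) = -1 :=
    Int.isUnit_iff.1 <| IsUnit.prod_univ_iff.2 fun l ↦ Int.isUnit_iff.2 (hσ _)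
  obtain ⟨t, ht⟩ := hM k f g hf hg
  rw [hdet, ← ht]
  obtain h | h := hprod
  · exact ⟨t, by simp [h]⟩
  · exact ⟨-t, by cases t <;> simp [h]⟩

end Matrix

/-- The relation matrix of a state inherits total unimodularity. -/
theorem relMat_isTotallyUnimodular {V : Type*} [DecidableEq V] {A : Matrix V V ℤ}
    (hA : A.IsTotallyUnimodular) {sgn : V → ℤ} (hsgn : ∀ v, sgn v = 1 ∨ sgn v = -1)
    (s : Finset V) : (relMat A sgn s).IsTotallyUnimodular := by
  have hcol := hA.mul_col_sign (σ := fun v ↦ -sgn v) fun v ↦ by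
    obtain h | h := hsgn v <;> simp [h]
  have key := ((one_fromCols_isTotallyUnimodular_iff _).2 hcol).submatrix id
    fun w ↦ if w ∈ s then Sum.inr w else Sum.inl w
  convert key using 1
  ext v w
  by_cases hw : w ∈ s
  · have : ¬ (v = w ∧ v ∉ s) := by rintro ⟨rfl, h⟩; exact h hw
    simp [relMat, hw, this]
  · have : (v = w ∧ v ∉ s) ↔ v = w := ⟨fun h ↦ h.1, fun h ↦ ⟨h, h ▸ hw⟩⟩
    simp [relMat, hw, this, one_apply]

/-- Inserting `j` into a state changes only column `j` of the relation matrix. -/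
theorem relMat_insert_apply_of_ne {V : Type*} [DecidableEq V] (A : Matrix V V ℤ) (sgn : V → ℤ)
    (s : Finset V) {j w : V} (hw : w ≠ j) (v : V) :
    relMat A sgn (insert j s) v w = relMat A sgn s v w := by
  have : (v = w ∧ v ∉ insert j s) ↔ (v = w ∧ v ∉ s) := by
    constructor <;> rintro ⟨rfl, h⟩ <;> simp_all
  simp only [relMat, this]
  simp only [Finset.mem_insert, hw, false_or]

/-- for distinct `i, j ∈ V₀` with `sgn i = sgn j = -1` and a state `s`
avoiding `i, j`, if `x_i = 0` in `V(s ∪ {i})`, `x_j = 0` in `V(s ∪ {j})`, while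
`x_i ≠ 0 ≠ x_j` in `V(s ∪ {i, j})`, then `x_i ± x_j = 0` in `V(s ∪ {i, j})` for some
sign `ε ∈ {−1, 1}`. Here `A` is a bipartite skew-symmetric integer matrix all of whose
minors lie in `{-1, 0, 1}`. -/
theorem stmt18 {V₀ V₁ : Type*} [Fintype V₀] [Fintype V₁] [DecidableEq V₀] [DecidableEq V₁]
    (A : Matrix (V₀ ⊕ V₁) (V₀ ⊕ V₁) ℤ) (hskew : Aᵀ = -A)
    (hbip₀ : ∀ i j : V₀, A (Sum.inl i) (Sum.inl j) = 0)
    (hbip₁ : ∀ i j : V₁, A (Sum.inr i) (Sum.inr j) = 0)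
    (hTU : ∀ (k : ℕ) (f : Fin k → V₀ ⊕ V₁) (g : Fin k → V₀ ⊕ V₁),
      Function.Injective f → Function.Injective g →
      (A.submatrix f g).det ∈ ({-1, 0, 1} : Set ℤ))
    (sgn : V₀ ⊕ V₁ → ℤ) (hsgn : ∀ v, sgn v = 1 ∨ sgn v = -1)
    (i j : V₀) (hij : i ≠ j)
    (hsi : sgn (Sum.inl i) = -1) (hsj : sgn (Sum.inl j) = -1)
    (s : Finset (V₀ ⊕ V₁)) (hi : Sum.inl i ∉ s) (hj : Sum.inl j ∉ s)
    (hxi : Pi.single (Sum.inl i) (1 : ℤ) ∈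
      Submodule.span ℤ (Set.range (relMat A sgn (insert (Sum.inl i) s))))
    (hxj : Pi.single (Sum.inl j) (1 : ℤ) ∈
      Submodule.span ℤ (Set.range (relMat A sgn (insert (Sum.inl j) s))))
    (hxi' : Pi.single (Sum.inl i) (1 : ℤ) ∉
      Submodule.span ℤ (Set.range (relMat A sgn (insert (Sum.inl i) (insert (Sum.inl j) s)))))
    (hxj' : Pi.single (Sum.inl j) (1 : ℤ) ∉
      Submodule.span ℤ (Set.range (relMat A sgn (insert (Sum.inl i) (insert (Sum.inl j) s))))) :
    ∃ ε : ℤ, (ε = 1 ∨ ε = -1) ∧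
      Pi.single (Sum.inl i) (1 : ℤ) + ε • Pi.single (Sum.inl j) (1 : ℤ) ∈
        Submodule.span ℤ (Set.range (relMat A sgn (insert (Sum.inl i) (insert (Sum.inl j) s)))) := by
  have hA : A.IsTotallyUnimodular := fun k f g hf hg ↦ by
    obtain h | h | h := hTU k f g hf hg
    · exact ⟨-1, by simp [h]⟩
    · exact ⟨0, by simp [h]⟩
    · exact ⟨1, by simp [Set.mem_singleton_iff.1 h]⟩
  set L := Submodule.span ℤ
    (Set.range (relMat A sgn (insert (Sum.inl i) (insert (Sum.inl j) s)))) with hL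
  obtain ⟨a, ha⟩ :
      ∃ a : ℤ, Pi.single (Sum.inl i) (1 : ℤ) + a • Pi.single (Sum.inl j) (1 : ℤ) ∈ L := by
    rw [hL, Finset.insert_comm]
    exact exists_add_smul_single_mem_span _
      (fun k w hw ↦ (relMat_insert_apply_of_ne A sgn _ hw k).symm) hxi
  obtain ⟨b, hb⟩ :
      ∃ b : ℤ, Pi.single (Sum.inl j) (1 : ℤ) + b • Pi.single (Sum.inl i) (1 : ℤ) ∈ L :=
    exists_add_smul_single_mem_span _
      (fun k w hw ↦ (relMat_insert_apply_of_ne A sgn _ hw k).symm) hxj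
  have hab : 1 - a * b = 0 := by
    by_contra hne
    refine hxi' ((relMat_isTotallyUnimodular hA hsgn _).mem_span_of_smul_mem_span hne ?_)
    convert L.sub_mem ha (L.smul_mem a hb) using 1
    module
  exact ⟨a, Int.isUnit_iff.1 (IsUnit.of_mul_eq_one b (by linarith)), ha⟩
end

section
/- Let A be a skew-symmetric integer matrix indexed by a finite set V and let a : V → ℤ. Let à be the skew-symmetric integer matrix indexed by {v, w} ⊔ V (v, w two new elements) defined by: à v w = à w v = 0; à v t = à w t = a(t) and à t v = à t w = −a(t) for t ∈ V; and à agreeing with A on V × V. Then for every state s ⊆ V: corank Ã(s ∪ {v}) = corank Ã(s ∪ {w}) = corank Ã(s ∪ {v, w}) − 1, and corank Ã(s) = corank A(s). -/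
open Matrix

/-- The rank of the principal submatrix `A(s)` over `ℚ` does not change when `A(s)` is the pullback
of `B(t)` along a map `f` with `f(s) = t`: repeating rows and columns does not affect the rank. -/
theorem rank_principal_eq_of_image_eq {V W : Type*} [DecidableEq W]
    (A : Matrix V V ℤ) (B : Matrix W W ℤ) {s : Finset V} {t : Finset W} (f : V → W)
    (hf : s.image f = t) (h : ∀ x ∈ s, ∀ y ∈ s, A x y = B (f x) (f y)) :
    ((A.submatrix (Subtype.val : s → V) (Subtype.val : s → V)).map (Int.cast : ℤ → ℚ)).rank =
      ((B.submatrix (Subtype.val : t → W) (Subtype.val : t → W)).map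
        (Int.cast : ℤ → ℚ)).rank := by
  subst hf
  let F : s → s.image f := fun x => ⟨f x, Finset.mem_image_of_mem f x.2⟩
  have hF : Function.Surjective F := by
    rintro ⟨y, hy⟩
    obtain ⟨x, hx, rfl⟩ := Finset.mem_image.mp hy
    exact ⟨⟨x, hx⟩, rfl⟩
  obtain ⟨G, hG⟩ := hF.hasRightInverse
  set M := (A.submatrix (Subtype.val : s → V) (Subtype.val : s → V)).map (Int.cast : ℤ → ℚ)
  set N := (B.submatrix (Subtype.val : s.image f → W) (Subtype.val : s.image f → W)).map
    (Int.cast : ℤ → ℚ)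
  have hM : M = N.submatrix F F := by
    ext x y
    simp [M, N, F, h x x.2 y y.2]
  have hN : N = M.submatrix G G := by
    rw [hM, submatrix_submatrix, hG.comp_eq_id, submatrix_id_id]
  apply le_antisymm
  · rw [hM]
    exact rank_submatrix_le _ _ _
  · rw [hN]
    exact rank_submatrix_le _ _ _

/-- move Ω₂: let `Atil` be obtained from the skew-symmetric matrix `A`
by adding two new nonadjacent vertices `v = Sum.inl 0` and `w = Sum.inl 1` with equal
row `a` (and column `-a`) against `V`. Then for every state `s ⊆ V`:
`corank Atil(s ∪ {v}) = corank Atil(s ∪ {w}) = corank Atil(s ∪ {v, w}) - 1` and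
`corank Atil(s) = corank A(s)`. -/
theorem stmt19 {V : Type*} [Fintype V] [DecidableEq V]
    (A : Matrix V V ℤ) (hA : Aᵀ = -A) (a : V → ℤ)
    (Atil : Matrix (Fin 2 ⊕ V) (Fin 2 ⊕ V) ℤ)
    (h1 : ∀ x y : Fin 2, Atil (Sum.inl x) (Sum.inl y) = 0)
    (h2 : ∀ (x : Fin 2) (t : V), Atil (Sum.inl x) (Sum.inr t) = a t)
    (h3 : ∀ (x : Fin 2) (t : V), Atil (Sum.inr t) (Sum.inl x) = -a t)
    (h4 : ∀ t t' : V, Atil (Sum.inr t) (Sum.inr t') = A t t') :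
    ∀ s : Finset V,
      pcorank Atil (insert (Sum.inl 0) (s.image Sum.inr)) =
          pcorank Atil (insert (Sum.inl 1) (s.image Sum.inr)) ∧
      pcorank Atil (insert (Sum.inl 0) (s.image Sum.inr)) =
          pcorank Atil (insert (Sum.inl 0) (insert (Sum.inl 1) (s.image Sum.inr))) - 1 ∧
      pcorank Atil (s.image Sum.inr) = pcorank A s := by
  intro s
  have hmap (k : Fin 2) : (s.image Sum.inr : Finset (Fin 2 ⊕ V)).image (Sum.map (fun _ => k) id) =
      s.image Sum.inr := by
    rw [Finset.image_image]
    rfl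
  have hAtil (k : Fin 2) (x y : Fin 2 ⊕ V) :
      Atil x y = Atil (Sum.map (fun _ => k) id x) (Sum.map (fun _ => k) id y) := by
    rcases x with x | x <;> rcases y with y | y <;> simp [h1, h2, h3]
  unfold pcorank
  refine ⟨?_, ?_, ?_⟩
  · rw [rank_principal_eq_of_image_eq Atil Atil (t := insert (Sum.inl 1) (s.image Sum.inr))
      (Sum.map (fun _ => (1 : Fin 2)) id)
      (by rw [Finset.image_insert, hmap]; rfl) fun x _ y _ => hAtil 1 x y]
    simp
  · rw [← rank_principal_eq_of_image_eq Atil Atil (s := insert (Sum.inl 0) (insert (Sum.inl 1) _))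
      (Sum.map (fun _ => (0 : Fin 2)) id)
      (by rw [Finset.image_insert, Finset.image_insert, hmap]; simp) fun x _ y _ => hAtil 0 x y]
    rw [Finset.card_insert_of_notMem (a := Sum.inl 0) (s := insert (Sum.inl 1) _) (by simp),
      Finset.card_insert_of_notMem (by simp), Finset.card_insert_of_notMem (by simp)]
    push_cast
    ring
  · rw [← rank_principal_eq_of_image_eq A Atil Sum.inr rfl fun x _ y _ => (h4 x y).symm,
      Finset.card_image_of_injective s Sum.inr_injective]
end
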